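/- Suppose M is a computable structure that is cofinally ultrahomogeneous. Then M is EmbedInfo(M)''-computably cofinally ultrahomogeneous, where EmbedInfo(M)'' denotes the double Turing jump of the degree of EmbedInfo(𝕂[M]). -/

import Mathlib

/- Self-contained framework for computable ages and cofinal Fraïssé limits. -/

namespace CFL

open Classical

/-! ### Oracle computability -/

/-- The characteristic partial function of a set of naturals. -/
noncomputable def chi (A : Set ℕ) : ℕ →. ℕ :=
  fun n => Part.some (if n ∈ A then 1 else 0)

/-- Codes for oracle partial recursive functions. -/
inductive OCode : Type
  | zero : OCode
  | succ : OCode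
  | left : OCode
  | right : OCode
  | oracle : OCode
  | pair : OCode → OCode → OCode
  | comp : OCode → OCode → OCode
  | prec : OCode → OCode → OCode
  | rfind' : OCode → OCode

/-- Evaluation of an oracle code relative to an oracle `O`. -/
def OCode.eval (O : ℕ →. ℕ) : OCode → ℕ →. ℕ
  | OCode.zero => pure 0
  | OCode.succ => Nat.succ
  | OCode.left => ↑fun n : ℕ => n.unpair.1
  | OCode.right => ↑fun n : ℕ => n.unpair.2
  | OCode.oracle => O
  | OCode.pair cf cg => fun n => Nat.pair <$> OCode.eval O cf n <*> OCode.eval O cg n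
  | OCode.comp cf cg => fun n => OCode.eval O cg n >>= OCode.eval O cf
  | OCode.prec cf cg =>
    Nat.unpaired fun a n =>
      n.rec (OCode.eval O cf a) fun y IH => do
        let i ← IH
        OCode.eval O cg (Nat.pair a (Nat.pair y i))
  | OCode.rfind' cf =>
    Nat.unpaired fun a m =>
      (Nat.rfind fun n => (fun m => m = 0) <$> OCode.eval O cf (Nat.pair a (n + m))).map
        (· + m)

/-- A numerical code of an `OCode`. -/
def OCode.encodeCode : OCode → ℕ
  | OCode.zero => 0
  | OCode.succ => 1
  | OCode.left => 2
  | OCode.right => 3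
  | OCode.oracle => 4
  | OCode.pair cf cg => 4 * Nat.pair cf.encodeCode cg.encodeCode + 5
  | OCode.comp cf cg => 4 * Nat.pair cf.encodeCode cg.encodeCode + 6
  | OCode.prec cf cg => 4 * Nat.pair cf.encodeCode cg.encodeCode + 7
  | OCode.rfind' cf => 4 * cf.encodeCode + 8

/-- `f` is a partial function recursive in the oracle set `O`. -/
def RecFunIn (O : Set ℕ) (f : ℕ →. ℕ) : Prop :=
  ∃ c : OCode, OCode.eval (chi O) c = f

/-- The code `c` computes the total function `f` relative to the oracle set `O`. -/
def ComputesIn (O : Set ℕ) (c : OCode) (f : ℕ → ℕ) : Prop :=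
  ∀ n, OCode.eval (chi O) c n = Part.some (f n)

/-- `f` is a total function computable in the oracle set `O`. -/
def TotalComputableIn (O : Set ℕ) (f : ℕ → ℕ) : Prop :=
  ∃ c : OCode, ComputesIn O c f

/-- The set `A` is computable in the oracle set `O`. -/
def SetRecIn (O A : Set ℕ) : Prop := RecFunIn O (chi A)

/-- Turing reducibility (on sets of naturals, regarded as representatives of
Turing degrees). -/
def TuringLE (A B : Set ℕ) : Prop := SetRecIn B A

/-- The set `A` is computably enumerable in the oracle set `O`. -/
def CEIn (O A : Set ℕ) : Prop :=
  ∃ c : OCode, ∀ n, n ∈ A ↔ (OCode.eval (chi O) c n).Dom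

/-- The Turing jump of a set of naturals. -/
def jump (O : Set ℕ) : Set ℕ :=
  { e | ∃ c : OCode, c.encodeCode = (Nat.unpair e).1 ∧
      (OCode.eval (chi O) c (Nat.unpair e).2).Dom }

/-- `0'`, the jump of the least degree. -/
def zeroJump : Set ℕ := jump ∅

/-- `0''`. -/
def zeroJump2 : Set ℕ := jump zeroJump

/-- `0'''`. -/
def zeroJump3 : Set ℕ := jump zeroJump2

/-! ### Languages and structures -/

/-- A (coded) first-order language: `relArity r = some k` means that `r` is the code of a
relation symbol of arity `k`, and similarly for function symbols. -/
structure Lang where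
  relArity : ℕ → Option ℕ
  funArity : ℕ → Option ℕ

/-- The language is computably represented. -/
def Lang.ComputableRep (L : Lang) : Prop :=
  TotalComputableIn ∅ (fun r => Encodable.encode (L.relArity r)) ∧
  TotalComputableIn ∅ (fun f => Encodable.encode (L.funArity f))

/-- A finite relational language. -/
def Lang.FiniteRelational (L : Lang) : Prop :=
  (∀ f, L.funArity f = none) ∧ { r | (L.relArity r).isSome = true }.Finite

/-- A finite language. -/
def Lang.FiniteLang (L : Lang) : Prop :=
  { r | (L.relArity r).isSome = true }.Finite ∧
  { f | (L.funArity f).isSome = true }.Finite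

/-- An `L`-structure with underlying set a set of naturals. -/
structure Str (L : Lang) where
  dom : Set ℕ
  rel : ℕ → List ℕ → Prop
  fn : ℕ → List ℕ → ℕ
  rel_valid : ∀ r as, rel r as → L.relArity r = some as.length ∧ ∀ x ∈ as, x ∈ dom
  fn_mem : ∀ f as, L.funArity f = some as.length → (∀ x ∈ as, x ∈ dom) → fn f as ∈ dom

variable {L : Lang}

/-- The (finite) tuple `as` lies in the structure `A`. -/
def TupleIn (A : Str L) (as : List ℕ) : Prop := ∀ x ∈ as, x ∈ A.dom

/-- Membership in the substructure of `A` generated by the tuple `s`. -/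
inductive InClosure (A : Str L) (s : List ℕ) : ℕ → Prop
  | base {x : ℕ} : x ∈ s → x ∈ A.dom → InClosure A s x
  | fn (f : ℕ) (as : List ℕ) : L.funArity f = some as.length →
      (∀ x ∈ as, InClosure A s x) → InClosure A s (A.fn f as)

theorem InClosure.mem_dom {A : Str L} {s : List ℕ} {x : ℕ}
    (h : InClosure A s x) : x ∈ A.dom := by
  induction h with
  | base _ hx => exact hx
  | fn f as ha _ ih => exact A.fn_mem f as ha ih

/-- The substructure of `A` generated by the tuple `s`. -/
def Str.sub (A : Str L) (s : List ℕ) : Str L where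
  dom := { x | InClosure A s x }
  rel r as := A.rel r as ∧ ∀ x ∈ as, InClosure A s x
  fn := A.fn
  rel_valid := fun r as h => ⟨(A.rel_valid r as h.1).1, h.2⟩
  fn_mem := fun f as ha hm => InClosure.fn f as ha hm

/-- `h` is an embedding of `A` into `B`. -/
def IsEmbMap (A B : Str L) (h : ℕ → ℕ) : Prop :=
  (∀ x ∈ A.dom, h x ∈ B.dom) ∧
  (∀ x ∈ A.dom, ∀ y ∈ A.dom, h x = h y → x = y) ∧
  (∀ r as, TupleIn A as → (A.rel r as ↔ B.rel r (as.map h))) ∧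
  (∀ f as, L.funArity f = some as.length → TupleIn A as →
    h (A.fn f as) = B.fn f (as.map h))

/-- `A` embeds into `B`. -/
def Embeds (A B : Str L) : Prop := ∃ h, IsEmbMap A B h

/-- `h` is an isomorphism of `A` onto `B`. -/
def IsIsoMap (A B : Str L) (h : ℕ → ℕ) : Prop :=
  IsEmbMap A B h ∧ ∀ y ∈ B.dom, ∃ x ∈ A.dom, h x = y

/-- `A` and `B` are isomorphic. -/
def Isom (A B : Str L) : Prop := ∃ h, IsIsoMap A B h

/-- `as ∼cl bs`: the coordinatewise map extends to an isomorphism of generated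
substructures. -/
def ClSim (A : Str L) (as : List ℕ) (B : Str L) (bs : List ℕ) : Prop :=
  ∃ h : ℕ → ℕ, as.map h = bs ∧ IsIsoMap (A.sub as) (B.sub bs) h

/-- `as ∼tuple bs`: equal length and the same pattern of equalities among coordinates. -/
def TupleSim (as bs : List ℕ) : Prop :=
  ∃ h h' : ℕ → ℕ, as.map h = bs ∧ bs.map h' = as

/-- `A` is finitely generated. -/
def Str.FG (A : Str L) : Prop :=
  ∃ s : List ℕ, TupleIn A s ∧ ∀ x, x ∈ A.dom ↔ InClosure A s x

/-- `g` is an automorphism of `M`. -/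
def IsAutoOf (M : Str L) (g : ℕ → ℕ) : Prop := IsIsoMap M M g

/-! ### Ages (as isomorphism-closed classes) -/

/-- `B` belongs to the age of `M`, i.e. `B` is isomorphic to a finitely generated
substructure of `M`. -/
def AgeMemOf (M : Str L) (B : Str L) : Prop :=
  ∃ as : List ℕ, TupleIn M as ∧ Isom B (M.sub as)

/-- The age of a structure `M`. -/
def ageOf (M : Str L) : Set (Str L) := { B | AgeMemOf M B }

/-- The hereditary property. -/
def HP (C : Set (Str L)) : Prop :=
  ∀ B ∈ C, ∀ as : List ℕ, TupleIn B as → B.sub as ∈ C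

/-- The joint embedding property. -/
def JEP (C : Set (Str L)) : Prop :=
  ∀ A ∈ C, ∀ B ∈ C, ∃ D ∈ C, Embeds A D ∧ Embeds B D

/-- Every pair of embeddings with domain `A` into members of `C` can be amalgamated
over `A` inside `C`. -/
def AmalgamatesOver (C : Set (Str L)) (A : Str L) : Prop :=
  ∀ B₀ ∈ C, ∀ B₁ ∈ C, ∀ f₀ f₁ : ℕ → ℕ, IsEmbMap A B₀ f₀ → IsEmbMap A B₁ f₁ →
    ∃ D ∈ C, ∃ g₀ g₁ : ℕ → ℕ, IsEmbMap B₀ D g₀ ∧ IsEmbMap B₁ D g₁ ∧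
      ∀ x ∈ A.dom, g₀ (f₀ x) = g₁ (f₁ x)

/-- The amalgamation property. -/
def AP (C : Set (Str L)) : Prop := ∀ A ∈ C, AmalgamatesOver C A

/-- `A` is an amalgamation base of the class `C`. -/
def AmalgBase (C : Set (Str L)) (A : Str L) : Prop := A ∈ C ∧ AmalgamatesOver C A

/-- The cofinal amalgamation property. -/
def CoAP (C : Set (Str L)) : Prop :=
  ∀ A ∈ C, ∃ A' : Str L, AmalgBase C A' ∧ Embeds A A'

/-! ### Computable ages -/

/-- An (abstract) enumerated age: for each index `i`, a generating tuple `tup i` and the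
structure `str i` it generates. -/
structure CompAge (L : Lang) where
  tup : ℕ → List ℕ
  str : ℕ → Str L
  tup_mem : ∀ i, TupleIn (str i) (tup i)
  gen : ∀ i x, x ∈ (str i).dom ↔ InClosure (str i) (tup i) x

/-- The class of structures represented by the enumerated age `K`. -/
def CompAge.cls (K : CompAge L) : Set (Str L) := { B | ∃ i, Isom B (K.str i) }

/-- The structure `M` is computable in the oracle set `s`. -/
def StrComputableIn (s : Set ℕ) (M : Str L) : Prop :=
  SetRecIn s M.dom ∧
  SetRecIn s { p | ∃ r as, TupleIn M as ∧ M.rel r as ∧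
      p = Nat.pair r (Encodable.encode as) } ∧
  SetRecIn s { p | ∃ f as b, L.funArity f = some as.length ∧ TupleIn M as ∧
      M.fn f as = b ∧ p = Nat.pair f (Nat.pair (Encodable.encode as) b) }

/-- The coded diagram of an enumerated age. -/
def CompAge.diag (K : CompAge L) : Set ℕ :=
  { p | ∃ i, p = Nat.pair 0 (Nat.pair i (Encodable.encode (K.tup i))) } ∪
  { p | ∃ i x, x ∈ (K.str i).dom ∧ p = Nat.pair 1 (Nat.pair i x) } ∪
  { p | ∃ i r as, TupleIn (K.str i) as ∧ (K.str i).rel r as ∧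
      p = Nat.pair 2 (Nat.pair i (Nat.pair r (Encodable.encode as))) } ∪
  { p | ∃ i r as, TupleIn (K.str i) as ∧ L.relArity r = some as.length ∧
      ¬ (K.str i).rel r as ∧
      p = Nat.pair 3 (Nat.pair i (Nat.pair r (Encodable.encode as))) } ∪
  { p | ∃ i f as b, TupleIn (K.str i) as ∧ L.funArity f = some as.length ∧
      (K.str i).fn f as = b ∧
      p = Nat.pair 4 (Nat.pair i (Nat.pair f (Nat.pair (Encodable.encode as) b))) }

/-- `K` is an `s`-computable age: its diagram is c.e. in `s` and each of its structures
is computable in `s`. -/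
def AgeComputableIn (s : Set ℕ) (K : CompAge L) : Prop :=
  CEIn s K.diag ∧ ∀ i, StrComputableIn s (K.str i)

/-- The embedding information of an enumerated age, as a set of naturals. -/
def EmbedInfo (K : CompAge L) : Set ℕ :=
  { p | ∃ k₀ b₀ k₁ b₁, TupleIn (K.str k₀) b₀ ∧ TupleIn (K.str k₁) b₁ ∧
      ClSim (K.str k₀) b₀ (K.str k₁) b₁ ∧
      p = Nat.pair k₀ (Nat.pair (Encodable.encode b₀)
            (Nat.pair k₁ (Encodable.encode b₁))) }

/-! ### Potential embeddings, spans, and amalgamation diagrams -/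

/-- A potential embedding: a pair of indices and a tuple in the codomain structure. -/
structure PotEmb where
  i : ℕ
  j : ℕ
  c : List ℕ

/-- A numerical code of a potential embedding. -/
def PotEmb.code (F : PotEmb) : ℕ :=
  Nat.pair F.i (Nat.pair F.j (Encodable.encode F.c))

/-- The potential embedding is well-formed with respect to `K`. -/
def PotEmb.Valid (K : CompAge L) (F : PotEmb) : Prop :=
  F.c.length = (K.tup F.i).length ∧ TupleIn (K.str F.j) F.c

/-- The potential embedding is an embedding. -/
def PotEmb.IsEmb (K : CompAge L) (F : PotEmb) : Prop :=
  ClSim (K.str F.i) (K.tup F.i) (K.str F.j) F.c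

/-- The potential embedding is an isomorphism (its range generates the codomain). -/
def PotEmb.IsIso (K : CompAge L) (F : PotEmb) : Prop :=
  F.IsEmb K ∧ ∀ x ∈ (K.str F.j).dom, InClosure (K.str F.j) F.c x

/-- `h` realizes the potential embedding `F` as a map on the domain structure. -/
def ExtMap (K : CompAge L) (F : PotEmb) (h : ℕ → ℕ) : Prop :=
  (K.tup F.i).map h = F.c ∧ IsEmbMap (K.str F.i) (K.str F.j) h

/-- `(F₀, F₁)` is a potential span. -/
def PotSpan (K : CompAge L) (F₀ F₁ : PotEmb) : Prop :=
  F₀.Valid K ∧ F₁.Valid K ∧ F₀.i = F₁.i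

/-- `(G₀, G₁)` is an amalgamation diagram over the potential span `(F₀, F₁)`. -/
def AmalgDiagOver (K : CompAge L) (F₀ F₁ G₀ G₁ : PotEmb) : Prop :=
  G₀.Valid K ∧ G₁.Valid K ∧ G₀.IsEmb K ∧
  G₀.i = F₀.j ∧ G₁.i = F₁.j ∧ G₀.j = G₁.j ∧
  (F₀.IsEmb K → F₁.IsEmb K → G₁.IsEmb K ∧
    ∀ h₀ h₁ : ℕ → ℕ, ExtMap K G₀ h₀ → ExtMap K G₁ h₁ →
      F₀.c.map h₀ = F₁.c.map h₁)

/-- `H` is the composition `F ∘ G` of potential embeddings (where `F` is an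
embedding realized by any `h` extending it). -/
def CompRel (K : CompAge L) (F G H : PotEmb) : Prop :=
  G.j = F.i ∧ H.i = G.i ∧ H.j = F.j ∧
  ∀ h : ℕ → ℕ, ExtMap K F h → H.c = G.c.map h

/-! ### Computable versions of HP, JEP, AP, coAP -/

/-- The `s`-computable hereditary property. -/
def CHP (s : Set ℕ) (K : CompAge L) : Prop :=
  ∃ c : OCode, ∀ i (b : List ℕ), TupleIn (K.str i) b →
    ∃ j, OCode.eval (chi s) c (Nat.pair i (Encodable.encode b)) = Part.some j ∧
      ClSim (K.str j) (K.tup j) (K.str i) b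

/-- The `s`-computable joint embedding property. -/
def CJEP (s : Set ℕ) (K : CompAge L) : Prop :=
  ∃ c : OCode, ∀ i j : ℕ, ∃ F G : PotEmb,
    OCode.eval (chi s) c (Nat.pair i j) = Part.some (Nat.pair F.code G.code) ∧
    F.Valid K ∧ G.Valid K ∧ F.IsEmb K ∧ G.IsEmb K ∧
    F.i = i ∧ G.i = j ∧ F.j = G.j

/-- The `s`-computable amalgamation property. -/
def CAP (s : Set ℕ) (K : CompAge L) : Prop :=
  ∃ c : OCode, ∀ F₀ F₁ : PotEmb, PotSpan K F₀ F₁ →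
    ∃ G₀ G₁ : PotEmb,
      OCode.eval (chi s) c (Nat.pair F₀.code F₁.code) =
        Part.some (Nat.pair G₀.code G₁.code) ∧
      AmalgDiagOver K F₀ F₁ G₀ G₁

/-- A family `W` of distinguished embeddings with amalgamation-base codomains, closed
under pre/post composition with isomorphisms, covering all domains. -/
def IsCoAPFamily (K : CompAge L) (W : Set PotEmb) : Prop :=
  (∀ F ∈ W, F.Valid K ∧ F.IsEmb K ∧ AmalgBase K.cls (K.str F.j)) ∧
  (∀ F ∈ W, ∀ G H : PotEmb, G.Valid K → G.IsIso K → G.j = F.i →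
      CompRel K F G H → H ∈ W) ∧
  (∀ F ∈ W, ∀ G H : PotEmb, G.Valid K → G.IsIso K → G.i = F.j →
      CompRel K G F H → H ∈ W) ∧
  (∀ i : ℕ, ∃ F ∈ W, F.i = i)

/-- The `s`-computable cofinal amalgamation property: there is an `s`-c.e. family of
distinguished embeddings onto amalgamation bases together with an `s`-computable
amalgamation function. -/
def CcoAP (s : Set ℕ) (K : CompAge L) : Prop :=
  ∃ W : Set PotEmb, IsCoAPFamily K W ∧
    CEIn s { p | ∃ F ∈ W, p = F.code } ∧
    ∃ c : OCode, ∀ F ∈ W, ∀ G₀ G₁ : PotEmb,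
      G₀.Valid K → G₁.Valid K → G₀.i = F.j → G₁.i = F.j →
      ∃ D₀ D₁ : PotEmb,
        OCode.eval (chi s) c (Nat.pair F.code (Nat.pair G₀.code G₁.code)) =
          Part.some (Nat.pair D₀.code D₁.code) ∧
        AmalgDiagOver K G₀ G₁ D₀ D₁

/-! ### Ultrahomogeneity -/

/-- `M` is ultrahomogeneous: every isomorphism between finitely generated substructures
extends to an automorphism. -/
def Ultrahomogeneous (M : Str L) : Prop :=
  ∀ as bs : List ℕ, TupleIn M as → TupleIn M bs → ClSim M as M bs →
    ∃ g : ℕ → ℕ, IsAutoOf M g ∧ as.map g = bs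

/-- `g` is a bijection of the underlying set of `M` with itself. -/
def BijOnDom (M : Str L) (g : ℕ → ℕ) : Prop :=
  (∀ x ∈ M.dom, g x ∈ M.dom) ∧
  (∀ x ∈ M.dom, ∀ y ∈ M.dom, g x = g y → x = y) ∧
  (∀ y ∈ M.dom, ∃ x ∈ M.dom, g x = y)

/-- `M` is `s`-computably ultrahomogeneous. -/
def CompUltrahom (s : Set ℕ) (M : Str L) : Prop :=
  ∃ c : OCode, ∀ as bs : List ℕ, TupleIn M as → TupleIn M bs →
    as.length = bs.length →
    ∃ e : ℕ,
      OCode.eval (chi s) c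
          (Nat.pair (Encodable.encode as) (Encodable.encode bs)) = Part.some e ∧
      ∃ c' : OCode, c'.encodeCode = e ∧ ∃ g : ℕ → ℕ, ComputesIn s c' g ∧
        BijOnDom M g ∧
        (ClSim M as M bs → IsAutoOf M g ∧ as.map g = bs)

/-! ### Cofinal ultrahomogeneity -/

/-- `M` is cofinally ultrahomogeneous. -/
def CofinallyUltrahomogeneous (M : Str L) : Prop :=
  ∀ as : List ℕ, TupleIn M as → ∃ bs : List ℕ, TupleIn M bs ∧
    (∀ x ∈ as, InClosure M bs x) ∧
    ∀ cs : List ℕ, TupleIn M cs → ClSim M bs M cs →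
      ∃ g : ℕ → ℕ, IsAutoOf M g ∧ bs.map g = cs

/-- `E` is a cofinal collection of tuples in `M`. -/
def IsCofinalCollection (M : Str L) (E : Set (List ℕ)) : Prop :=
  (∀ bs ∈ E, TupleIn M bs) ∧
  (∀ as : List ℕ, TupleIn M as → ∃ bs ∈ E, ∀ x ∈ as, InClosure M bs x) ∧
  (∀ bs ∈ E, ∀ as : List ℕ, (∀ x ∈ as, InClosure M bs x) → (as ++ bs) ∈ E) ∧
  (∀ as ∈ E, ∀ bs : List ℕ, TupleIn M bs → ClSim M as M bs → bs ∈ E)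

/-- `M` is cofinally ultrahomogeneous for the collection `E`: every isomorphism between
substructures generated by members of `E` extends to an automorphism. -/
def CofUltraFor (M : Str L) (E : Set (List ℕ)) : Prop :=
  ∀ as ∈ E, ∀ bs ∈ E, ClSim M as M bs →
    ∃ g : ℕ → ℕ, IsAutoOf M g ∧ as.map g = bs

/-- The set of codes of members of `E`. -/
def ECodes (E : Set (List ℕ)) : Set ℕ := { p | ∃ as ∈ E, p = Encodable.encode as }

/-- The functional part of `s`-computable cofinal ultrahomogeneity with respect to `E`. -/
def CofUltraFunIn (s : Set ℕ) (M : Str L) (E : Set (List ℕ)) : Prop :=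
  ∃ c : OCode, ∀ as ∈ E, ∀ bs : List ℕ, TupleIn M bs → TupleSim as bs →
    ∃ e : ℕ,
      OCode.eval (chi s) c
          (Nat.pair (Encodable.encode as) (Encodable.encode bs)) = Part.some e ∧
      ∃ c' : OCode, c'.encodeCode = e ∧ ∃ g : ℕ → ℕ, ComputesIn s c' g ∧
        BijOnDom M g ∧ as.map g = bs ∧
        (ClSim M as M bs → IsAutoOf M g)

/-- `M` is `s`-computably cofinally ultrahomogeneous with respect to `E`. -/
def CompCofUltrahomWrt (s : Set ℕ) (M : Str L) (E : Set (List ℕ)) : Prop :=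
  IsCofinalCollection M E ∧ SetRecIn s (ECodes E) ∧ CofUltraFunIn s M E

/-- `M` is `s`-computably cofinally ultrahomogeneous. -/
def CompCofUltrahom (s : Set ℕ) (M : Str L) : Prop :=
  ∃ E : Set (List ℕ), CompCofUltrahomWrt s M E

/-- The `s`-computable cofinal extension property with respect to `E`. -/
def CompCofExtProp (s : Set ℕ) (M : Str L) (E : Set (List ℕ)) : Prop :=
  ∃ c : OCode, ∀ as bs cs : List ℕ, as ∈ E → cs ∈ E → TupleIn M bs →
    (∀ x ∈ as, InClosure M cs x) → TupleSim as bs →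
    ∃ ds : List ℕ,
      OCode.eval (chi s) c
          (Nat.pair (Encodable.encode as)
            (Nat.pair (Encodable.encode bs) (Encodable.encode cs))) =
        Part.some (Encodable.encode ds) ∧
      TupleIn M ds ∧ TupleSim (as ++ cs) (bs ++ ds) ∧
      (ClSim M as M bs →
        ClSim M ds M cs ∧ (∀ x ∈ bs, InClosure M ds x) ∧
        ∀ h h' : ℕ → ℕ,
          ds.map h = cs → IsIsoMap (M.sub ds) (M.sub cs) h →
          bs.map h' = as → IsIsoMap (M.sub bs) (M.sub as) h' →
          bs.map h = bs.map h')

/-! ### Canonical ages and limits -/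

/-- `K` is a canonical age of `M` (relative to the oracle `t`): the enumeration of
generating tuples is `t`-computable, lists every finite tuple of `M` infinitely often,
and `str i` is the substructure generated by `tup i`. -/
def IsCanonicalAgeOf (t : Set ℕ) (K : CompAge L) (M : Str L) : Prop :=
  TotalComputableIn t (fun i => Encodable.encode (K.tup i)) ∧
  (∀ i, TupleIn M (K.tup i)) ∧
  (∀ as : List ℕ, TupleIn M as → ∀ n : ℕ, ∃ i, n ≤ i ∧ K.tup i = as) ∧
  (∀ i, K.str i = M.sub (K.tup i))

/-- `K` represents the age of `M`. -/
def RepresentsAgeOf (K : CompAge L) (M : Str L) : Prop :=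
  (∀ i, AgeMemOf M (K.str i)) ∧
  (∀ B : Str L, AgeMemOf M B → ∃ i, Isom B (K.str i))

/-- `M` is a cofinal Fraïssé limit of (the age represented by) `K`. -/
def CofinalFraisseLimitOf (K : CompAge L) (M : Str L) : Prop :=
  CofinallyUltrahomogeneous M ∧ RepresentsAgeOf K M

/-- The enumerated age `K` is uniformly finite. -/
def UniformlyFinite (K : CompAge L) : Prop :=
  L.FiniteLang ∧ ∃ f : ℕ → ℕ, TotalComputableIn ∅ f ∧
    ∀ i, ∀ as : List ℕ, TupleIn (K.str i) as →
      { x | InClosure (K.str i) as x }.Finite ∧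
      { x | InClosure (K.str i) as x }.ncard ≤ f as.length


/-! ### Computability relative to an oracle -/

/-- The code obtained by answering oracle queries with the code `d`. -/
def OCode.substOracle (d : OCode) : OCode → OCode
  | OCode.zero => OCode.zero
  | OCode.succ => OCode.succ
  | OCode.left => OCode.left
  | OCode.right => OCode.right
  | OCode.oracle => d
  | OCode.pair cf cg => OCode.pair (substOracle d cf) (substOracle d cg)
  | OCode.comp cf cg => OCode.comp (substOracle d cf) (substOracle d cg)
  | OCode.prec cf cg => OCode.prec (substOracle d cf) (substOracle d cg)
  | OCode.rfind' cf => OCode.rfind' (substOracle d cf)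

theorem OCode.eval_substOracle {O O' : ℕ →. ℕ} {d : OCode} (hd : OCode.eval O' d = O)
    (c : OCode) : OCode.eval O' (OCode.substOracle d c) = OCode.eval O c := by
  induction c with
  | zero | succ | left | right => rfl
  | oracle => exact hd
  | pair _ _ hf hg | comp _ _ hf hg | prec _ _ hf hg =>
    simp only [OCode.substOracle, OCode.eval, hf, hg]
    rfl
  | rfind' _ hf =>
    simp only [OCode.substOracle, OCode.eval, hf]
    rfl

theorem OCode.encodeCode_injective : Function.Injective OCode.encodeCode := by
  intro c
  induction c with
  | zero | succ | left | right | oracle =>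
    intro d h
    cases d <;> simp only [OCode.encodeCode] at h <;> first | rfl | omega
  | pair cf cg hf hg | comp cf cg hf hg | prec cf cg hf hg =>
    intro d h
    cases d <;> simp only [OCode.encodeCode] at h <;> try omega
    rename_i cf' cg'
    have h' := Nat.pair_eq_pair.1 (show Nat.pair cf.encodeCode cg.encodeCode =
      Nat.pair cf'.encodeCode cg'.encodeCode by omega)
    rw [hf h'.1, hg h'.2]
  | rfind' cf hf =>
    intro d h
    cases d <;> simp only [OCode.encodeCode] at h <;> try omega
    rename_i cf'
    rw [hf (show cf.encodeCode = cf'.encodeCode by omega)]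

namespace TotalComputableIn

variable {O : Set ℕ} {f g : ℕ → ℕ}

theorem pair (hf : TotalComputableIn O f) (hg : TotalComputableIn O g) :
    TotalComputableIn O (fun n => Nat.pair (f n) (g n)) := by
  obtain ⟨c, hc⟩ := hf
  obtain ⟨d, hd⟩ := hg
  refine ⟨.pair c d, fun n => ?_⟩
  simp [OCode.eval, hc n, hd n, Seq.seq]

theorem comp (hf : TotalComputableIn O f) (hg : TotalComputableIn O g) :
    TotalComputableIn O (fun n => f (g n)) := by
  obtain ⟨c, hc⟩ := hf
  obtain ⟨d, hd⟩ := hg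
  refine ⟨.comp c d, fun n => ?_⟩
  simp only [OCode.eval, hd n]
  exact (Part.bind_some _ _).trans (hc (g n))

theorem prec (hf : TotalComputableIn O f) (hg : TotalComputableIn O g) :
    TotalComputableIn O (Nat.unpaired fun z n =>
      n.rec (f z) fun y IH => g (Nat.pair z (Nat.pair y IH))) := by
  obtain ⟨c, hc⟩ := hf
  obtain ⟨d, hd⟩ := hg
  refine ⟨.prec c d, fun n => ?_⟩
  simp only [OCode.eval, Nat.unpaired]
  generalize n.unpair.1 = a
  induction n.unpair.2 with
  | zero => exact hc a
  | succ k ih =>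
    refine (congrArg (fun x => Part.bind x _) ih).trans ?_
    exact (Part.bind_some _ _).trans (hd _)

theorem of_natPrimrec (hf : Nat.Primrec f) : TotalComputableIn O f := by
  induction hf with
  | zero => exact ⟨.zero, fun _ => rfl⟩
  | succ => exact ⟨.succ, fun _ => rfl⟩
  | left => exact ⟨.left, fun _ => rfl⟩
  | right => exact ⟨.right, fun _ => rfl⟩
  | pair _ _ hf hg => exact hf.pair hg
  | comp _ _ hf hg => exact hf.comp hg
  | prec _ _ hf hg => exact hf.prec hg

theorem of_primrec (hf : Primrec f) : TotalComputableIn O f :=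
  of_natPrimrec (Primrec.nat_iff.1 hf)

theorem mono {A : Set ℕ} (hA : SetRecIn O A) (hf : TotalComputableIn A f) :
    TotalComputableIn O f := by
  obtain ⟨d, hd⟩ := hA
  obtain ⟨c, hc⟩ := hf
  exact ⟨.substOracle d c, fun n => by rw [OCode.eval_substOracle hd, hc n]⟩

end TotalComputableIn

theorem setRecIn_iff {O A : Set ℕ} :
    SetRecIn O A ↔ TotalComputableIn O (fun n => if n ∈ A then 1 else 0) :=
  ⟨fun ⟨c, hc⟩ => ⟨c, fun n => by rw [hc]; rfl⟩, fun ⟨c, hc⟩ => ⟨c, funext hc⟩⟩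

theorem setRecIn_self (O : Set ℕ) : SetRecIn O O := ⟨.oracle, rfl⟩

theorem setRecIn_empty (O : Set ℕ) : SetRecIn O ∅ :=
  setRecIn_iff.2 (by simpa using TotalComputableIn.of_primrec (Primrec.const 0))

/-- A code searching for the least `m` at which the code `c` takes the value `0`. -/
def OCode.search (c : OCode) : OCode :=
  .comp (.rfind' c) (.pair (.pair .left .right) .zero)

theorem OCode.mem_eval_search {O : Set ℕ} {c : OCode} {f : ℕ → ℕ} (hc : ComputesIn O c f)
    (n m : ℕ) : m ∈ OCode.eval (chi O) (OCode.search c) n ↔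
      f (Nat.pair n m) = 0 ∧ ∀ k < m, f (Nat.pair n k) ≠ 0 := by
  have hc' : ∀ n, OCode.eval (chi O) c n = Part.some (f n) := hc
  have h : OCode.eval (chi O) (OCode.search c) n =
      Nat.rfind ((fun m => decide (f (Nat.pair n m) = 0) : ℕ → Bool) : ℕ →. Bool) := by
    simp only [OCode.search, OCode.eval, hc', Seq.seq, pure, PFun.pure]
    simp [PFun.lift]
    exact Part.map_id' (fun _ => rfl) _
  rw [h, Nat.mem_rfind]
  simp [PFun.lift]

theorem OCode.eval_search_dom {O : Set ℕ} {c : OCode} {f : ℕ → ℕ} (hc : ComputesIn O c f)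
    (n : ℕ) :
    (OCode.eval (chi O) (OCode.search c) n).Dom ↔ ∃ m, f (Nat.pair n m) = 0 := by
  rw [Part.dom_iff_mem]
  simp only [OCode.mem_eval_search hc]
  exact ⟨fun ⟨m, h, _⟩ => ⟨m, h⟩,
    fun h => ⟨Nat.find h, Nat.find_spec h, fun _ hk => Nat.find_min h hk⟩⟩

theorem TotalComputableIn.exists_zero {O : Set ℕ} {f : ℕ → ℕ} (hf : TotalComputableIn O f)
    (h : ∀ n, ∃ m, f (Nat.pair n m) = 0) :
    ∃ g, TotalComputableIn O g ∧ ∀ n, f (Nat.pair n (g n)) = 0 := by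
  obtain ⟨c, hc⟩ := hf
  have hd n := (OCode.eval_search_dom hc n).2 (h n)
  refine ⟨fun n => (OCode.eval (chi O) c.search n).get (hd n), ⟨c.search, fun n => ?_⟩, fun n => ?_⟩
  · exact (Part.some_get _).symm
  · exact ((OCode.mem_eval_search hc n _).1 (Part.get_mem (hd n))).1

theorem setRecIn_jump_exists_zero {O : Set ℕ} {f : ℕ → ℕ} (hf : TotalComputableIn O f) :
    SetRecIn (jump O) {n | ∃ m, f (Nat.pair n m) = 0} := by
  obtain ⟨c, hc⟩ := hf
  have key : ∀ n, n ∈ {n | ∃ m, f (Nat.pair n m) = 0} ↔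
      Nat.pair c.search.encodeCode n ∈ jump O := by
    intro n
    simp only [jump, Set.mem_ofPred_eq, Nat.unpair_pair, ← OCode.eval_search_dom hc n]
    constructor
    · exact fun h => ⟨_, rfl, h⟩
    · rintro ⟨d, hd, h⟩
      rwa [OCode.encodeCode_injective hd] at h
  rw [setRecIn_iff]
  simp only [key]
  exact (setRecIn_iff.1 (setRecIn_self (jump O))).comp
    (.pair (.of_primrec (Primrec.const _)) (.of_primrec Primrec.id))

theorem setRecIn_jump_of_setRecIn {O A : Set ℕ} (h : SetRecIn O A) : SetRecIn (jump O) A := by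
  have h₁ := (TotalComputableIn.of_primrec (O := O)
    (f := fun n => 1 - n) (Primrec.nat_sub.comp (.const 1) .id)).comp
    ((setRecIn_iff.1 h).comp
      (.of_primrec (f := fun n => n.unpair.1) (Primrec.fst.comp Primrec.unpair)))
  have h₂ := setRecIn_jump_exists_zero h₁
  convert h₂ using 1
  ext n
  by_cases hn : n ∈ A <;> simp [hn]

/-! ### Relative computability on coded types -/

section Coded

open Encodable

variable {α β γ δ : Type} [Primcodable α] [Primcodable β] [Primcodable γ] [Primcodable δ]
  {O : Set ℕ}

/-- The function `f` between coded types is computable in the oracle set `O`. -/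
def FunIn (O : Set ℕ) (f : α → β) : Prop :=
  ∃ φ : ℕ → ℕ, TotalComputableIn O φ ∧ ∀ a, φ (encode a) = encode (f a)

/-- The predicate `P` on a coded type is decidable in the oracle set `O`. -/
def DecIn (O : Set ℕ) (P : α → Prop) : Prop := FunIn O (fun a => decide (P a))

namespace FunIn

theorem of_primrec {f : α → β} (hf : Primrec f) : FunIn O f := by
  refine ⟨_, (TotalComputableIn.of_primrec Primrec.pred).comp (.of_natPrimrec hf), fun a => ?_⟩
  simp

theorem comp {f : β → γ} {g : α → β} (hf : FunIn O f) (hg : FunIn O g) :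
    FunIn O (fun a => f (g a)) := by
  obtain ⟨φ, hφ, hφ'⟩ := hf
  obtain ⟨ψ, hψ, hψ'⟩ := hg
  exact ⟨_, hφ.comp hψ, fun a => by rw [hψ', hφ']⟩

theorem pair {f : α → β} {g : α → γ} (hf : FunIn O f) (hg : FunIn O g) :
    FunIn O (fun a => (f a, g a)) := by
  obtain ⟨φ, hφ, hφ'⟩ := hf
  obtain ⟨ψ, hψ, hψ'⟩ := hg
  exact ⟨_, hφ.pair hψ, fun a => by rw [hψ', hφ', encode_prod_val]⟩

theorem mono {A : Set ℕ} {f : α → β} (hA : SetRecIn O A) (hf : FunIn A f) : FunIn O f := by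
  obtain ⟨φ, hφ, hφ'⟩ := hf
  exact ⟨φ, hφ.mono hA, hφ'⟩

theorem natRec {f : α → β} {g : α × (ℕ × β) → β} (hf : FunIn O f) (hg : FunIn O g) :
    FunIn O (fun x : α × ℕ =>
      (Nat.rec (f x.1) (fun n ih => g (x.1, (n, ih))) x.2 : β)) := by
  obtain ⟨φ, hφ, hφ'⟩ := hf
  obtain ⟨ψ, hψ, hψ'⟩ := hg
  refine ⟨_, hφ.prec hψ, fun ⟨a, n⟩ => ?_⟩
  simp only [encode_prod_val, Nat.unpaired, Nat.unpair_pair, encode_nat]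
  induction n with
  | zero => exact hφ' a
  | succ k ih =>
    simp only [ih]
    rw [← hψ', encode_prod_val, encode_prod_val, encode_nat]

end FunIn

namespace DecIn

theorem of_primrecPred {P : α → Prop} (hP : PrimrecPred P) : DecIn O P :=
  FunIn.of_primrec hP.decide

theorem comp {P : β → Prop} {f : α → β} (hP : DecIn O P) (hf : FunIn O f) :
    DecIn O (fun a => P (f a)) := FunIn.comp hP hf

theorem not {P : α → Prop} (hP : DecIn O P) : DecIn O (fun a => ¬ P a) := by
  have := (FunIn.of_primrec (O := O) Primrec.not).comp hP
  simpa [DecIn] using this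

theorem and {P Q : α → Prop} (hP : DecIn O P) (hQ : DecIn O Q) :
    DecIn O (fun a => P a ∧ Q a) := by
  have := (FunIn.of_primrec (O := O) Primrec.and).comp (FunIn.pair hP hQ)
  simpa [DecIn] using this

theorem imp {P Q : α → Prop} (hP : DecIn O P) (hQ : DecIn O Q) :
    DecIn O (fun a => P a → Q a) := by
  have := (hP.and hQ.not).not
  simpa [DecIn] using this

theorem mono {A : Set ℕ} {P : α → Prop} (hA : SetRecIn O A) (hP : DecIn A P) : DecIn O P :=
  FunIn.mono hA hP

theorem jump {P : α → Prop} (hP : DecIn O P) : DecIn (CFL.jump O) P :=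
  hP.mono (setRecIn_jump_of_setRecIn (setRecIn_self O))

theorem of_setRecIn {A : Set ℕ} (hA : SetRecIn O A) : DecIn O (fun n => n ∈ A) :=
  ⟨_, setRecIn_iff.1 hA, fun n => by by_cases h : n ∈ A <;> simp [h]⟩

/-- A function on codes whose zeros are the codes of witnesses for `P`. -/
theorem exists_witness_code {P : α × β → Prop} (hP : DecIn O P) :
    ∃ f : ℕ → ℕ, TotalComputableIn O f ∧ ∀ a m,
      f (Nat.pair (encode a) m) = 0 ↔ ∃ b, decode m = some b ∧ P (a, b) := by
  obtain ⟨φ, hφ, hφ'⟩ := hP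
  have hdec : TotalComputableIn O (fun m => encode (decode m : Option β)) :=
    .of_natPrimrec (Primcodable.prim β)
  have hl : TotalComputableIn O (fun n => n.unpair.1) := .of_natPrimrec .left
  have hr : TotalComputableIn O (fun n => n.unpair.2) := .of_natPrimrec .right
  have h₁ := hdec.comp hr
  have h₂ := hφ.comp (hl.pair ((TotalComputableIn.of_primrec Primrec.pred).comp h₁))
  have h₃ : TotalComputableIn O
      (fun n => if n.unpair.1 = 0 then 1 else 1 - n.unpair.2) :=
    .of_primrec (.ite (Primrec.eq.comp (Primrec.fst.comp .unpair) (.const 0)) (.const 1)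
      (Primrec.nat_sub.comp (.const 1) (Primrec.snd.comp .unpair)))
  refine ⟨_, h₃.comp (h₁.pair h₂), fun a m => ?_⟩
  simp only [Nat.unpair_pair]
  rcases hm : (decode m : Option β) with _ | b
  · simp
  · have := hφ' (a, b)
    rw [encode_prod_val] at this
    simp only [encode_some, Nat.pred_succ, Nat.succ_eq_add_one, Nat.add_one_ne_zero, if_false, this]
    by_cases h : P (a, b) <;> simp [h]

theorem exists_snd {P : α × β → Prop} (hP : DecIn O P) :
    DecIn (CFL.jump O) (fun a => ∃ b, P (a, b)) := by
  obtain ⟨f, hf, hf'⟩ := hP.exists_witness_code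
  refine ⟨_, setRecIn_iff.1 (setRecIn_jump_exists_zero hf), fun a => ?_⟩
  have : (∃ m, f (Nat.pair (encode a) m) = 0) ↔ ∃ b, P (a, b) := by
    simp only [hf']
    exact ⟨fun ⟨_, b, _, h⟩ => ⟨b, h⟩, fun ⟨b, h⟩ => ⟨encode b, b, encodek b, h⟩⟩
  by_cases h : ∃ b, P (a, b)
  · simp [this, h]
  · simp only [Set.mem_ofPred_eq, this, h, if_false, decide_false, encode_false]

theorem forall_snd {P : α × β → Prop} (hP : DecIn O P) :
    DecIn (CFL.jump O) (fun a => ∀ b, P (a, b)) := by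
  have := hP.not.exists_snd.not
  simpa [DecIn] using this

/-- Unbounded search: a total decidable relation has a computable choice function. -/
theorem exists_choice {P : α × β → Prop} (hP : DecIn O P) (h : ∀ a, ∃ b, P (a, b)) :
    ∃ f : α → β, FunIn O f ∧ ∀ a, P (a, f a) := by
  obtain ⟨f, hf, hf'⟩ := hP.exists_witness_code
  have hdec : TotalComputableIn O (fun m => encode (decode m : Option α)) :=
    .of_natPrimrec (Primcodable.prim α)
  have hl : TotalComputableIn O (fun n => n.unpair.1) := .of_natPrimrec .left
  have hr : TotalComputableIn O (fun n => n.unpair.2) := .of_natPrimrec .right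
  have hd := hdec.comp hl
  have h₂ := hf.comp (((TotalComputableIn.of_primrec Primrec.pred).comp hd).pair hr)
  have h₃ : TotalComputableIn O (fun n => if n.unpair.1 = 0 then 0 else n.unpair.2) :=
    .of_primrec (.ite (Primrec.eq.comp (Primrec.fst.comp .unpair) (.const 0)) (.const 0)
      (Primrec.snd.comp .unpair))
  obtain ⟨g, hg, hg'⟩ := (h₃.comp (hd.pair h₂)).exists_zero (fun n => by
    simp only [Nat.unpair_pair]
    rcases (decode n : Option α) with _ | a
    · simp
    · obtain ⟨b, hb⟩ := h a
      exact ⟨encode b, by simpa using (hf' a (encode b)).2 ⟨b, encodek b, hb⟩⟩)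
  have key : ∀ a, ∃ b, decode (g (encode a)) = some b ∧ P (a, b) := fun a =>
    (hf' a _).1 (by simpa using hg' (encode a))
  choose F hF using key
  refine ⟨F, ⟨_, (TotalComputableIn.of_primrec Primrec.pred).comp
    ((TotalComputableIn.of_natPrimrec (Primcodable.prim β)).comp hg), fun a => ?_⟩,
    fun a => (hF a).2⟩
  simp [(hF a).1]

end DecIn

theorem FunIn.ite {P : α → Prop} {f g : α → β} (hP : DecIn O P) (hf : FunIn O f)
    (hg : FunIn O g) : FunIn O (fun a => if P a then f a else g a) := by
  have h : Primrec (fun x : Bool × (β × β) => bif x.1 then x.2.1 else x.2.2) :=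
    .cond .fst (Primrec.fst.comp .snd) (Primrec.snd.comp .snd)
  have := (FunIn.of_primrec (O := O) h).comp (FunIn.pair hP (hf.pair hg))
  simpa [Bool.cond_decide] using this

theorem setRecIn_of_decIn {P : List ℕ → Prop} (h : DecIn O P) :
    SetRecIn O {p | ∃ as, P as ∧ p = encode as} := by
  obtain ⟨φ, hφ, hφ'⟩ := h
  rw [setRecIn_iff]
  convert hφ using 2 with n
  obtain ⟨as, rfl⟩ : ∃ as : List ℕ, n = encode as :=
    ⟨Denumerable.ofNat _ n, (Denumerable.encode_ofNat n).symm⟩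
  have hmem : encode as ∈ {p | ∃ as, P as ∧ p = encode as} ↔ P as :=
    ⟨fun ⟨bs, hb, e⟩ => encode_injective e ▸ hb, fun h => ⟨as, h, rfl⟩⟩
  rw [hφ']
  by_cases h : P as
  · simp only [hmem, h, if_true, decide_true, encode_true]
  · simp only [hmem, h, if_false, decide_false, encode_false]

end Coded

/-! ### Currying of codes -/

/-- A code of the constant function with value `n`. -/
def OCode.const : ℕ → OCode
  | 0 => .zero
  | n + 1 => .comp .succ (.const n)

theorem OCode.eval_const (O : ℕ →. ℕ) (n m : ℕ) :
    OCode.eval O (OCode.const n) m = Part.some n := by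
  induction n with
  | zero => rfl
  | succ n ih =>
    simp only [OCode.const, OCode.eval, ih]
    exact Part.bind_some _ _

/-- The code of `m ↦ c (n, m)`. -/
def OCode.curry (c : OCode) (n : ℕ) : OCode :=
  .comp c (.pair (.const n) (.pair .left .right))

theorem ComputesIn.curry {O : Set ℕ} {c : OCode} {f : ℕ → ℕ} (hc : ComputesIn O c f) (n : ℕ) :
    ComputesIn O (c.curry n) (fun m => f (Nat.pair n m)) := by
  intro m
  simp only [OCode.curry, OCode.eval, OCode.eval_const, Seq.seq]
  simp only [PFun.coe_val, Part.map_eq_map, Part.map_some, Part.bind_some, Nat.pair_unpair]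
  exact (Part.bind_some _ _).trans (hc _)

theorem OCode.primrec_encodeCode_const : Primrec (fun n => (OCode.const n).encodeCode) := by
  have h : Primrec (fun m => 4 * Nat.pair 1 m + 6) :=
    Primrec.nat_add.comp (Primrec.nat_mul.comp (.const 4)
      (Primrec₂.natPair.comp (.const 1) .id)) (.const 6)
  refine (Primrec.nat_rec₁ 0 (f := fun _ m => 4 * Nat.pair 1 m + 6) (h.comp .snd)).of_eq
    fun n => ?_
  induction n with
  | zero => rfl
  | succ n ih => simp only [OCode.const, OCode.encodeCode, ← ih]

theorem OCode.primrec_encodeCode_curry (c : OCode) :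
    Primrec (fun n => (c.curry n).encodeCode) := by
  have h₁ : Primrec (fun m => 4 * Nat.pair m (OCode.pair .left .right).encodeCode + 5) :=
    Primrec.nat_add.comp (Primrec.nat_mul.comp (.const 4)
      (Primrec₂.natPair.comp .id (.const _))) (.const 5)
  have h₂ : Primrec (fun m => 4 * Nat.pair c.encodeCode m + 6) :=
    Primrec.nat_add.comp (Primrec.nat_mul.comp (.const 4)
      (Primrec₂.natPair.comp (.const _) .id)) (.const 6)
  exact h₂.comp (h₁.comp OCode.primrec_encodeCode_const)

/-! ### Embeddings, generated substructures and automorphisms -/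

theorem tupleIn_append {M : Str L} {as bs : List ℕ} :
    TupleIn M (as ++ bs) ↔ TupleIn M as ∧ TupleIn M bs := by
  simp only [TupleIn, List.mem_append]
  exact ⟨fun h => ⟨fun x hx => h x (.inl hx), fun x hx => h x (.inr hx)⟩,
    fun h x hx => hx.elim (h.1 x) (h.2 x)⟩

theorem tupleIn_cons {M : Str L} {x : ℕ} {as : List ℕ} :
    TupleIn M (x :: as) ↔ x ∈ M.dom ∧ TupleIn M as := by
  simp [TupleIn]

theorem IsEmbMap.tupleIn_map {A B : Str L} {h : ℕ → ℕ} (hh : IsEmbMap A B h) {as : List ℕ}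
    (ha : TupleIn A as) : TupleIn B (as.map h) := by
  intro y hy
  obtain ⟨x, hx, rfl⟩ := List.mem_map.1 hy
  exact hh.1 x (ha x hx)

theorem IsEmbMap.comp {A B C : Str L} {g h : ℕ → ℕ} (hg : IsEmbMap B C g)
    (hh : IsEmbMap A B h) : IsEmbMap A C (g ∘ h) := by
  refine ⟨fun x hx => hg.1 _ (hh.1 x hx),
    fun x hx y hy e => hh.2.1 x hx y hy (hg.2.1 _ (hh.1 x hx) _ (hh.1 y hy) e),
    fun r as ha => ?_, fun f as hl ha => ?_⟩
  · rw [hh.2.2.1 r as ha, hg.2.2.1 r _ (hh.tupleIn_map ha), List.map_map]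
  · rw [Function.comp, hh.2.2.2 f as hl ha,
      hg.2.2.2 f _ (by rw [List.length_map, hl]) (hh.tupleIn_map ha), List.map_map]

theorem IsIsoMap.comp {A B C : Str L} {g h : ℕ → ℕ} (hg : IsIsoMap B C g)
    (hh : IsIsoMap A B h) : IsIsoMap A C (g ∘ h) := by
  refine ⟨hg.1.comp hh.1, fun z hz => ?_⟩
  obtain ⟨y, hy, rfl⟩ := hg.2 z hz
  obtain ⟨x, hx, rfl⟩ := hh.2 y hy
  exact ⟨x, hx, rfl⟩

theorem IsIsoMap.exists_inverse {A B : Str L} {h : ℕ → ℕ} (hh : IsIsoMap A B h) :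
    ∃ k, IsIsoMap B A k ∧ (∀ x ∈ A.dom, k (h x) = x) := by
  have hs : ∀ y, ∃ x, y ∈ B.dom → x ∈ A.dom ∧ h x = y := fun y => by
    by_cases hy : y ∈ B.dom
    · obtain ⟨x, hx⟩ := hh.2 y hy
      exact ⟨x, fun _ => hx⟩
    · exact ⟨0, fun hy' => absurd hy' hy⟩
  choose k hk using hs
  have hkh : ∀ x ∈ A.dom, k (h x) = x := fun x hx =>
    hh.1.2.1 _ (hk _ (hh.1.1 x hx)).1 x hx (hk _ (hh.1.1 x hx)).2
  have hmap : ∀ as, TupleIn B as → (as.map k).map h = as := fun as ha => by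
    rw [List.map_map]
    exact (List.map_congr_left fun x hx => (hk x (ha x hx)).2).trans (List.map_id _)
  have htup : ∀ as, TupleIn B as → TupleIn A (as.map k) := fun as ha y hy => by
    obtain ⟨x, hx, rfl⟩ := List.mem_map.1 hy
    exact (hk x (ha x hx)).1
  refine ⟨k, ⟨⟨fun y hy => (hk y hy).1, fun x hx y hy e => ?_, fun r as ha => ?_,
    fun f as hl ha => ?_⟩, fun x hx => ⟨h x, hh.1.1 x hx, hkh x hx⟩⟩, hkh⟩
  · rw [← (hk x hx).2, ← (hk y hy).2, e]
  · rw [hh.1.2.2.1 r _ (htup as ha), hmap as ha]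
  · have hl' : L.funArity f = some (as.map k).length := by rw [List.length_map, hl]
    have := hh.1.2.2.2 f _ hl' (htup as ha)
    rw [hmap as ha] at this
    rw [← this, hkh _ (A.fn_mem f _ hl' (htup as ha))]

theorem Str.sub_eq_of_closure_iff {M : Str L} {s t : List ℕ}
    (h : ∀ x, InClosure M s x ↔ InClosure M t x) : M.sub s = M.sub t := by
  have : InClosure M s = InClosure M t := funext fun x => propext (h x)
  simp only [Str.sub, this]

theorem InClosure.of_generators {M : Str L} {s t : List ℕ} (h : ∀ x ∈ s, InClosure M t x)
    {x : ℕ} (hx : InClosure M s x) : InClosure M t x := by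
  induction hx with
  | base hx _ => exact h _ hx
  | fn f as hl _ ih => exact .fn f as hl ih

theorem inClosure_sub_iff {M : Str L} {s : List ℕ} {x : ℕ} :
    InClosure (M.sub s) s x ↔ InClosure M s x := by
  constructor
  · exact fun h => h.mem_dom
  · intro h
    induction h with
    | base hx hd => exact .base hx (.base hx hd)
    | fn f as hl _ ih => exact .fn (A := M.sub s) f as hl ih

theorem Str.sub_sub_self (M : Str L) (s : List ℕ) : (M.sub s).sub s = M.sub s := by
  have : InClosure (M.sub s) s = InClosure M s :=
    funext fun x => propext inClosure_sub_iff
  have h : (M.sub s).sub s = ⟨{x | InClosure (M.sub s) s x},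
    fun r as => (M.rel r as ∧ ∀ x ∈ as, InClosure M s x) ∧
      ∀ x ∈ as, InClosure (M.sub s) s x, M.fn, _, _⟩ := rfl
  rw [h]
  simp only [this, and_assoc, and_self]
  rfl

theorem IsEmbMap.restrict {M N : Str L} {h : ℕ → ℕ} (hh : IsEmbMap M N h) (s : List ℕ) :
    IsEmbMap (M.sub s) N h :=
  ⟨fun x hx => hh.1 x (InClosure.mem_dom hx),
    fun x hx y hy => hh.2.1 x (InClosure.mem_dom hx) y (InClosure.mem_dom hy),
    fun r as ha => (and_iff_left_of_imp fun _ => ha).trans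
      (hh.2.2.1 r as fun x hx => InClosure.mem_dom (ha x hx)),
    fun f as hl ha => hh.2.2.2 f as hl fun x hx => InClosure.mem_dom (ha x hx)⟩

theorem IsEmbMap.inClosure_map {M N : Str L} {s : List ℕ} {h : ℕ → ℕ}
    (hh : IsEmbMap (M.sub s) N h) {x : ℕ} (hx : InClosure M s x) :
    InClosure N (s.map h) (h x) := by
  induction hx with
  | base hx hd => exact .base (List.mem_map_of_mem hx) (hh.1 _ (.base hx hd))
  | fn f as hl has ih =>
    rw [show h (M.fn f as) = N.fn f (as.map h) from hh.2.2.2 f as hl has]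
    refine .fn f _ (by rw [List.length_map, hl]) fun y hy => ?_
    obtain ⟨x, hx, rfl⟩ := List.mem_map.1 hy
    exact ih x hx

theorem IsEmbMap.exists_preimage {M N : Str L} {s : List ℕ} {h : ℕ → ℕ}
    (hh : IsEmbMap (M.sub s) N h) (hs : TupleIn M s) {y : ℕ}
    (hy : InClosure N (s.map h) y) : ∃ x, InClosure M s x ∧ h x = y := by
  induction hy with
  | base hy _ =>
    obtain ⟨x, hx, rfl⟩ := List.mem_map.1 hy
    exact ⟨x, .base hx (hs x hx), rfl⟩
  | fn f bs hl _ ih =>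
    choose! k hk using ih
    have e : (bs.map k).map h = bs := by
      rw [List.map_map]
      exact (List.map_congr_left fun x hx => (hk x hx).2).trans (List.map_id _)
    have hc : ∀ x ∈ bs.map k, InClosure M s x := fun x hx => by
      obtain ⟨y, hy, rfl⟩ := List.mem_map.1 hx
      exact (hk y hy).1
    have hl' : L.funArity f = some (bs.map k).length := by rw [List.length_map, hl]
    refine ⟨M.fn f (bs.map k), .fn f _ hl' hc, ?_⟩
    rw [show h (M.fn f (bs.map k)) = N.fn f ((bs.map k).map h) from hh.2.2.2 f _ hl' hc, e]

theorem IsEmbMap.clSim {M N : Str L} {s : List ℕ} {h : ℕ → ℕ}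
    (hh : IsEmbMap (M.sub s) N h) (hs : TupleIn M s) : ClSim M s N (s.map h) := by
  refine ⟨h, rfl, ⟨fun x hx => hh.inClosure_map hx, hh.2.1, fun r as ha => ?_, hh.2.2.2⟩,
    fun y hy => hh.exists_preimage hs hy⟩
  refine (hh.2.2.1 r as ha).trans (and_iff_left_of_imp fun _ y hy => ?_).symm
  obtain ⟨x, hx, rfl⟩ := List.mem_map.1 hy
  exact hh.inClosure_map (ha x hx)

theorem IsIsoMap.isEmbMap_of_sub {A N : Str L} {s : List ℕ} {h : ℕ → ℕ}
    (hh : IsIsoMap A (N.sub s) h) : IsEmbMap A N h := by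
  refine ⟨fun x hx => InClosure.mem_dom (hh.1.1 x hx), hh.1.2.1, fun r as ha => ?_, hh.1.2.2.2⟩
  exact (hh.1.2.2.1 r as ha).trans (and_iff_left_of_imp fun _ => hh.1.tupleIn_map ha)

theorem IsEmbMap.eq_of_eq_on_generators {M N : Str L} {s : List ℕ} {g h : ℕ → ℕ}
    (hg : IsEmbMap (M.sub s) N g) (hh : IsEmbMap (M.sub s) N h)
    (e : s.map g = s.map h) {x : ℕ} (hx : InClosure M s x) : g x = h x := by
  induction hx with
  | base hx _ => exact List.map_inj_left.1 e _ hx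
  | fn f as hl ha ih =>
    rw [show g (M.fn f as) = N.fn f (as.map g) from hg.2.2.2 f as hl ha,
      show h (M.fn f as) = N.fn f (as.map h) from hh.2.2.2 f as hl ha, List.map_congr_left ih]

theorem ClSim.trans {A B C : Str L} {as bs cs : List ℕ} (h₁ : ClSim A as B bs)
    (h₂ : ClSim B bs C cs) : ClSim A as C cs := by
  obtain ⟨f, rfl, hf⟩ := h₁
  obtain ⟨g, rfl, hg⟩ := h₂
  exact ⟨g ∘ f, (List.map_map).symm, hg.comp hf⟩

/-- Some automorphism of `M` maps the tuple `as` to the tuple `bs`. -/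
def SameOrbit (M : Str L) (as bs : List ℕ) : Prop :=
  TupleIn M as ∧ ∃ g, IsAutoOf M g ∧ as.map g = bs

namespace SameOrbit

variable {M : Str L} {as bs cs : List ℕ}

theorem tupleIn_right (h : SameOrbit M as bs) : TupleIn M bs := by
  obtain ⟨ha, g, hg, rfl⟩ := h
  exact hg.1.tupleIn_map ha

theorem symm (h : SameOrbit M as bs) : SameOrbit M bs as := by
  refine ⟨h.tupleIn_right, ?_⟩
  obtain ⟨ha, g, hg, rfl⟩ := h
  obtain ⟨k, hk, hkg⟩ := hg.exists_inverse
  refine ⟨k, hk, ?_⟩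
  rw [List.map_map]
  exact (List.map_congr_left fun x hx => hkg x (ha x hx)).trans (List.map_id _)

theorem trans (h₁ : SameOrbit M as bs) (h₂ : SameOrbit M bs cs) : SameOrbit M as cs := by
  obtain ⟨ha, g, hg, rfl⟩ := h₁
  obtain ⟨_, k, hk, rfl⟩ := h₂
  exact ⟨ha, k ∘ g, IsIsoMap.comp hk hg, (List.map_map).symm⟩

theorem clSim (h : SameOrbit M as bs) : ClSim M as M bs := by
  obtain ⟨ha, g, hg, rfl⟩ := h
  exact (hg.1.restrict as).clSim ha

theorem tupleSim (h : SameOrbit M as bs) : TupleSim as bs := by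
  obtain ⟨_, k, _, hk⟩ := h.symm
  obtain ⟨_, g, _, hg⟩ := h
  exact ⟨g, k, hg, hk⟩

theorem exists_cons (h : SameOrbit M as bs) {x : ℕ} (hx : x ∈ M.dom) :
    ∃ y, SameOrbit M (x :: as) (y :: bs) := by
  obtain ⟨ha, g, hg, rfl⟩ := h
  exact ⟨g x, tupleIn_cons.2 ⟨hx, ha⟩, g, hg, rfl⟩

end SameOrbit

/-- The tuples `as` of `M` such that every isomorphism from the substructure generated by `as`
onto a substructure of `M` extends to an automorphism of `M`. -/
def homogeneousTuples (M : Str L) : Set (List ℕ) :=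
  {as | TupleIn M as ∧ ∀ bs, TupleIn M bs → ClSim M as M bs → SameOrbit M as bs}

theorem append_mem_homogeneousTuples {M : Str L} {as bs : List ℕ}
    (hb : bs ∈ homogeneousTuples M) (ha : ∀ x ∈ as, InClosure M bs x) :
    as ++ bs ∈ homogeneousTuples M := by
  have hab : TupleIn M (as ++ bs) := tupleIn_append.2 ⟨fun x hx => (ha x hx).mem_dom, hb.1⟩
  refine ⟨hab, fun cs hcs hsim => ⟨hab, ?_⟩⟩
  obtain ⟨h, rfl, hh⟩ := hsim
  have hsub : M.sub (as ++ bs) = M.sub bs := Str.sub_eq_of_closure_iff fun x =>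
    ⟨.of_generators fun y hy => (List.mem_append.1 hy).elim (ha y) fun hy => .base hy (hb.1 y hy),
      .of_generators fun y hy => .base (List.mem_append_right _ hy) (hb.1 y hy)⟩
  have hemb := hh.isEmbMap_of_sub
  rw [hsub] at hemb
  rw [List.map_append, tupleIn_append] at hcs
  obtain ⟨_, g, hg, e⟩ := hb.2 _ hcs.2 (hemb.clSim hb.1)
  refine ⟨g, hg, ?_⟩
  rw [List.map_append, List.map_append, e, List.map_congr_left fun x hx =>
    (hg.1.restrict bs).eq_of_eq_on_generators hemb e (ha x hx)]

theorem isCofinalCollection_homogeneousTuples {M : Str L} (hM : CofinallyUltrahomogeneous M) :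
    IsCofinalCollection M (homogeneousTuples M) := by
  refine ⟨fun bs hb => hb.1, fun as ha => ?_, fun bs hb as => append_mem_homogeneousTuples hb,
    fun as ha bs hb hs => ⟨hb, fun cs hc hs' => ?_⟩⟩
  · obtain ⟨bs, hb, hcl, hext⟩ := hM as ha
    exact ⟨bs, ⟨hb, fun cs hc hs => ⟨hb, hext cs hc hs⟩⟩, hcl⟩
  · exact (ha.2 bs hb hs).symm.trans (ha.2 cs hc (hs.trans hs'))

theorem sameOrbit_iff {M : Str L} (hM : CofinallyUltrahomogeneous M) {as bs : List ℕ} :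
    SameOrbit M as bs ↔ TupleIn M as ∧ ∀ ds, TupleIn M ds →
      ∃ ws, TupleIn M ws ∧ ClSim M (as ++ ds) M ws ∧ ws.take as.length = bs := by
  constructor
  · rintro ⟨ha, g, hg, rfl⟩
    refine ⟨ha, fun ds hd => ⟨(as ++ ds).map g, ?_⟩⟩
    have h : SameOrbit M (as ++ ds) ((as ++ ds).map g) := ⟨tupleIn_append.2 ⟨ha, hd⟩, g, hg, rfl⟩
    exact ⟨h.tupleIn_right, h.clSim, by simp⟩
  · rintro ⟨ha, h⟩
    obtain ⟨ds, hd, hcl⟩ := (isCofinalCollection_homogeneousTuples hM).2.1 as ha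
    obtain ⟨ws, hw, hs, rfl⟩ := h ds hd.1
    obtain ⟨_, g, hg, rfl⟩ := (append_mem_homogeneousTuples hd hcl).2 ws hw hs
    exact ⟨ha, g, hg, by simp⟩

/-! ### Tuple similarity -/

theorem exists_map_eq_of_getElem? {p q : List ℕ}
    (h : ∀ i j : ℕ, p[i]? = p[j]? ↔ q[i]? = q[j]?) : ∃ f : ℕ → ℕ, p.map f = q := by
  refine ⟨fun x => (q[p.idxOf x]?).getD 0, List.ext_getElem? fun i => ?_⟩
  rw [List.getElem?_map]
  have hout : p[p.length + q.length]? = none ∧ q[p.length + q.length]? = none := by simp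
  have hi := h i (p.length + q.length)
  rw [hout.1, hout.2] at hi
  rcases hp : p[i]? with _ | x
  · exact (hi.1 hp).symm
  · have hx : p[p.idxOf x]? = some x := by
      have := List.mem_of_getElem? hp
      rw [List.getElem?_eq_getElem (List.idxOf_lt_length_iff.2 this), List.getElem_idxOf]
    have hq := (h (p.idxOf x) i).1 (hx.trans hp.symm)
    rcases hq' : q[i]? with _ | y
    · rw [hi.2 hq'] at hp
      cases hp
    · simp [hq, hq']

theorem tupleSim_iff {p q : List ℕ} :
    TupleSim p q ↔ ∀ i j : ℕ, p[i]? = p[j]? ↔ q[i]? = q[j]? := by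
  constructor
  · rintro ⟨f, g, hf, hg⟩ i j
    constructor
    · intro h
      rw [← hf, List.getElem?_map, List.getElem?_map, h]
    · intro h
      rw [← hg, List.getElem?_map, List.getElem?_map, h]
  · intro h
    obtain ⟨f, hf⟩ := exists_map_eq_of_getElem? h
    obtain ⟨g, hg⟩ := exists_map_eq_of_getElem? fun i j => (h i j).symm
    exact ⟨f, g, hf, hg⟩

theorem TupleSim.symm {p q : List ℕ} (h : TupleSim p q) : TupleSim q p := by
  obtain ⟨f, g, hf, hg⟩ := h
  exact ⟨g, f, hg, hf⟩

theorem TupleSim.exists_cons {D : Set ℕ} {p q : List ℕ} (h : TupleSim p q)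
    (hp : ∀ x ∈ p, x ∈ D) (hq : ∀ y ∈ q, y ∈ D) {x : ℕ} (hx : x ∈ D) :
    ∃ y ∈ D, TupleSim (x :: p) (y :: q) := by
  obtain ⟨f, g, rfl, hg⟩ := h
  by_cases hxp : x ∈ p
  · have hfx : f x ∈ p.map f := List.mem_map_of_mem hxp
    have hgf : g (f x) = x := by
      rw [List.map_map] at hg
      exact List.map_inj_left.1 (hg.trans (List.map_id p).symm) x hxp
    exact ⟨f x, hq _ hfx, f, g, rfl, by rw [List.map_cons, hg, hgf]⟩
  · obtain ⟨y, hy, hyq⟩ : ∃ y ∈ D, y ∉ p.map f := by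
      by_contra! hcon
      have hlt : p.toFinset.card < (p.map f).toFinset.card :=
        Finset.card_lt_card ⟨fun z hz => List.mem_toFinset.2 (hcon z (hp z (List.mem_toFinset.1 hz))),
          fun hs => hxp (List.mem_toFinset.1 (hs (List.mem_toFinset.2 (hcon x hx))))⟩
      have himg : (p.map f).toFinset = p.toFinset.image f := by
        ext
        simp
      exact absurd (himg ▸ Finset.card_image_le) hlt.not_ge
    refine ⟨y, hy, Function.update f x y, Function.update g y x, ?_, ?_⟩
    · rw [List.map_cons, Function.update_self]
      congr 1
      exact List.map_congr_left fun z hz =>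
        Function.update_of_ne (fun e : z = x => hxp (e ▸ hz)) _ _
    · rw [List.map_cons, Function.update_self]
      congr 1
      rw [List.map_congr_left fun z hz => Function.update_of_ne (fun e : z = y => hyq (e ▸ hz)) _ _, hg]


/-! ### Back-and-forth constructions -/

/-- The states `st n` (pairs of tuples) form a back-and-forth construction of a bijection of `D`:
stage `n` puts `n`, when it lies in `D`, into the domain and into the range. -/
structure IsBackAndForth (D : Set ℕ) (st : ℕ → List ℕ × List ℕ) : Prop where
  mem_left : ∀ n, ∀ x ∈ (st n).1, x ∈ D
  mem_right : ∀ n, ∀ x ∈ (st n).2, x ∈ D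
  tupleSim : ∀ n, TupleSim (st n).1 (st n).2
  step : ∀ n ∈ D, ∃ y z, st (n + 1) = (z :: n :: (st n).1, n :: y :: (st n).2)
  idle : ∀ n ∉ D, st (n + 1) = st n

/-- The map built by a sequence of states. -/
def limitMap (st : ℕ → List ℕ × List ℕ) (x : ℕ) : ℕ :=
  ((st (x + 1)).2[(st (x + 1)).1.idxOf x]?).getD 0

namespace IsBackAndForth

variable {D : Set ℕ} {st : ℕ → List ℕ × List ℕ}

theorem exists_append (h : IsBackAndForth D st) {m n : ℕ} (hmn : m ≤ n) :
    ∃ u v, u.length = v.length ∧ (st n).1 = u ++ (st m).1 ∧ (st n).2 = v ++ (st m).2 := by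
  induction n, hmn using Nat.le_induction with
  | base => exact ⟨[], [], rfl, rfl, rfl⟩
  | succ n _ ih =>
    obtain ⟨u, v, hl, hu, hv⟩ := ih
    by_cases hn : n ∈ D
    · obtain ⟨y, z, e⟩ := h.step n hn
      exact ⟨z :: n :: u, n :: y :: v, by simp [hl], by simp [e, hu], by simp [e, hv]⟩
    · exact ⟨u, v, hl, by rw [h.idle n hn, hu], by rw [h.idle n hn, hv]⟩

theorem mem_of_lt (h : IsBackAndForth D st) {x n : ℕ} (hx : x ∈ D) (hn : x < n) :
    x ∈ (st n).1 ∧ x ∈ (st n).2 := by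
  obtain ⟨u, v, -, hu, hv⟩ := h.exists_append (Nat.succ_le_of_lt hn)
  obtain ⟨y, z, e⟩ := h.step x hx
  rw [hu, hv, Nat.succ_eq_add_one, e]
  simp

theorem map_eq_of_le (h : IsBackAndForth D st) {m n : ℕ} (hmn : m ≤ n) {f : ℕ → ℕ}
    (hf : (st n).1.map f = (st n).2) : (st m).1.map f = (st m).2 := by
  obtain ⟨u, v, hl, hu, hv⟩ := h.exists_append hmn
  rw [hu, hv, List.map_append] at hf
  exact (List.append_inj hf (by simp [hl])).2

theorem limitMap_eq (h : IsBackAndForth D st) {x n : ℕ} (hx : x ∈ D) (hn : x < n) {f : ℕ → ℕ}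
    (hf : (st n).1.map f = (st n).2) : limitMap st x = f x := by
  have hm := (h.mem_of_lt hx (Nat.lt_succ_self x)).1
  have hi : (st (x + 1)).1[(st (x + 1)).1.idxOf x]? = some x := by
    rw [List.getElem?_eq_getElem (List.idxOf_lt_length_iff.2 hm), List.getElem_idxOf]
  rw [limitMap, ← h.map_eq_of_le (Nat.succ_le_of_lt hn) hf, List.getElem?_map, hi]
  rfl

theorem map_limitMap (h : IsBackAndForth D st) (n : ℕ) :
    (st n).1.map (limitMap st) = (st n).2 := by
  obtain ⟨f, -, hf, -⟩ := h.tupleSim n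
  rw [← hf]
  refine List.map_congr_left fun x hx => ?_
  obtain ⟨k, -, hk, -⟩ := h.tupleSim (max n (x + 1))
  rw [h.limitMap_eq (h.mem_left n x hx) (le_max_right n (x + 1)) hk]
  exact List.map_inj_left.1 ((h.map_eq_of_le (le_max_left _ _) hk).trans hf.symm) x hx

theorem bijOnDom {M : Str L} (h : IsBackAndForth M.dom st) : BijOnDom M (limitMap st) := by
  refine ⟨fun x hx => ?_, fun x hx y hy e => ?_, fun y hy => ?_⟩
  · refine h.mem_right (x + 1) _ ?_
    rw [← h.map_limitMap (x + 1)]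
    exact List.mem_map_of_mem (h.mem_of_lt hx (Nat.lt_succ_self x)).1
  · obtain ⟨f, k, hf, hk⟩ := h.tupleSim (max x y + 1)
    rw [h.limitMap_eq hx (by omega) hf, h.limitMap_eq hy (by omega) hf] at e
    rw [← hf, List.map_map] at hk
    have hkf : ∀ z ∈ (st (max x y + 1)).1, k (f z) = z :=
      List.map_inj_left.1 (hk.trans (List.map_id _).symm)
    rw [← hkf x (h.mem_of_lt hx (by omega)).1, e, hkf y (h.mem_of_lt hy (by omega)).1]
  · have hm := (h.mem_of_lt hy (Nat.lt_succ_self y)).2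
    rw [← h.map_limitMap] at hm
    obtain ⟨x, hx, e⟩ := List.mem_map.1 hm
    exact ⟨x, h.mem_left _ x hx, e⟩

theorem isAutoOf {M : Str L} (h : IsBackAndForth M.dom st)
    (hs : ∀ n, SameOrbit M (st n).1 (st n).2) : IsAutoOf M (limitMap st) := by
  have key : ∀ as : List ℕ, TupleIn M as → ∃ g, IsAutoOf M g ∧ ∀ x ∈ as, limitMap st x = g x := by
    intro as ha
    obtain ⟨n, hn⟩ : ∃ n, ∀ x ∈ as, x < n :=
      ⟨as.toFinset.sup id + 1, fun x hx =>
        Nat.lt_succ_of_le (Finset.le_sup (f := id) (List.mem_toFinset.2 hx))⟩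
    obtain ⟨-, g, hg, e⟩ := hs n
    exact ⟨g, hg, fun x hx => h.limitMap_eq (ha x hx) (hn x hx) e⟩
  obtain ⟨h₁, h₂, h₃⟩ := h.bijOnDom
  refine ⟨⟨h₁, h₂, fun r as ha => ?_, fun f as hl ha => ?_⟩, h₃⟩
  · obtain ⟨g, hg, e⟩ := key as ha
    rw [List.map_congr_left e]
    exact hg.1.2.2.1 r as ha
  · obtain ⟨g, hg, e⟩ := key (M.fn f as :: as) (tupleIn_cons.2 ⟨M.fn_mem f as hl ha, ha⟩)
    rw [List.map_congr_left fun x hx => e x (List.mem_cons_of_mem _ hx),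
      e _ List.mem_cons_self]
    exact hg.1.2.2.2 f as hl ha

end IsBackAndForth

/-- The invariant of the back-and-forth construction extending `ab.1 ↦ ab.2`. -/
def Compatible (M : Str L) (ab st : List ℕ × List ℕ) : Prop :=
  (TupleIn M st.1 ∧ TupleIn M st.2) ∧ TupleSim st.1 st.2 ∧
    (SameOrbit M ab.1 ab.2 → SameOrbit M st.1 st.2)

theorem Compatible.refl {M : Str L} {ab : List ℕ × List ℕ} (ha : TupleIn M ab.1)
    (hb : TupleIn M ab.2) (h : TupleSim ab.1 ab.2) : Compatible M ab ab :=
  ⟨⟨ha, hb⟩, h, id⟩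

theorem Compatible.swap {M : Str L} {ab : List ℕ × List ℕ} {p q : List ℕ}
    (h : Compatible M ab (p, q)) : Compatible M ab (q, p) :=
  ⟨h.1.symm, h.2.1.symm, fun ho => (h.2.2 ho).symm⟩

theorem Compatible.exists_cons {M : Str L} {ab : List ℕ × List ℕ} {p q : List ℕ}
    (h : Compatible M ab (p, q)) {x : ℕ} (hx : x ∈ M.dom) :
    ∃ y, Compatible M ab (x :: p, y :: q) := by
  by_cases ho : SameOrbit M ab.1 ab.2
  · obtain ⟨y, hy⟩ := (h.2.2 ho).exists_cons hx
    exact ⟨y, ⟨hy.1, hy.tupleIn_right⟩, hy.tupleSim, fun _ => hy⟩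
  · obtain ⟨y, hy, hs⟩ := h.2.1.exists_cons h.1.1 h.1.2 hx
    exact ⟨y, ⟨tupleIn_cons.2 ⟨hx, h.1.1⟩, tupleIn_cons.2 ⟨hy, h.1.2⟩⟩, hs,
      fun ho' => absurd ho' ho⟩

theorem Compatible.exists_step {M : Str L} {ab st : List ℕ × List ℕ}
    (h : Compatible M ab st) {x : ℕ} (hx : x ∈ M.dom) :
    ∃ yz : ℕ × ℕ, Compatible M ab (yz.2 :: x :: st.1, x :: yz.1 :: st.2) := by
  obtain ⟨y, hy⟩ := Compatible.exists_cons (p := st.1) (q := st.2) h hx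
  obtain ⟨z, hz⟩ := hy.swap.exists_cons hx
  exact ⟨(y, z), hz.swap⟩

/-- The sequence of states obtained from `ab` by repeatedly adding the elements that `F`
selects. -/
noncomputable def stage (M : Str L)
    (F : ((List ℕ × List ℕ) × (List ℕ × List ℕ)) × ℕ → ℕ × ℕ) (ab : List ℕ × List ℕ) (n : ℕ) :
    List ℕ × List ℕ :=
  Nat.rec ab (fun n st => if n ∈ M.dom then
    ((F ((ab, st), n)).2 :: n :: st.1, n :: (F ((ab, st), n)).1 :: st.2) else st) n

section Stage

variable {M : Str L} {F : ((List ℕ × List ℕ) × (List ℕ × List ℕ)) × ℕ → ℕ × ℕ}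
  {ab : List ℕ × List ℕ}

theorem stage_succ_of_mem {n : ℕ} (hn : n ∈ M.dom) :
    stage M F ab (n + 1) =
      ((F ((ab, stage M F ab n), n)).2 :: n :: (stage M F ab n).1,
        n :: (F ((ab, stage M F ab n), n)).1 :: (stage M F ab n).2) :=
  if_pos hn

theorem stage_succ_of_notMem {n : ℕ} (hn : n ∉ M.dom) :
    stage M F ab (n + 1) = stage M F ab n :=
  if_neg hn

theorem compatible_stage
    (hF : ∀ x : ((List ℕ × List ℕ) × (List ℕ × List ℕ)) × ℕ, Compatible M x.1.1 x.1.2 →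
      x.2 ∈ M.dom → Compatible M x.1.1 ((F x).2 :: x.2 :: x.1.2.1, x.2 :: (F x).1 :: x.1.2.2))
    (h : Compatible M ab ab) (n : ℕ) : Compatible M ab (stage M F ab n) := by
  induction n with
  | zero => exact h
  | succ n ih =>
    by_cases hn : n ∈ M.dom
    · rw [stage_succ_of_mem hn]
      exact hF ((ab, stage M F ab n), n) ih hn
    · rwa [stage_succ_of_notMem hn]

theorem isBackAndForth_stage (h : ∀ n, Compatible M ab (stage M F ab n)) :
    IsBackAndForth M.dom (stage M F ab) where
  mem_left n := (h n).1.1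
  mem_right n := (h n).1.2
  tupleSim n := (h n).2.1
  step _ hn := ⟨_, _, stage_succ_of_mem hn⟩
  idle _ hn := stage_succ_of_notMem hn

end Stage

/-! ### Decidability of the relevant relations -/

section Complexity

open Encodable

variable {M : Str L} {K : CompAge L}

theorem IsCanonicalAgeOf.tupleIn_iff {t : Set ℕ} (hK : IsCanonicalAgeOf t K M) {as : List ℕ} :
    TupleIn M as ↔ ∃ i, K.tup i = as := by
  constructor
  · intro h
    obtain ⟨i, -, hi⟩ := hK.2.2.1 as h 0
    exact ⟨i, hi⟩
  · rintro ⟨i, rfl⟩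
    exact hK.2.1 i

theorem IsCanonicalAgeOf.mem_embedInfo_iff {t : Set ℕ} (hK : IsCanonicalAgeOf t K M) (i j : ℕ) :
    Nat.pair i (Nat.pair (encode (K.tup i)) (Nat.pair j (encode (K.tup j)))) ∈ EmbedInfo K ↔
      ClSim M (K.tup i) M (K.tup j) := by
  have hsim : ClSim (K.str i) (K.tup i) (K.str j) (K.tup j) ↔ ClSim M (K.tup i) M (K.tup j) := by
    rw [hK.2.2.2 i, hK.2.2.2 j]
    simp only [ClSim, Str.sub_sub_self]
  rw [← hsim]
  constructor
  · rintro ⟨k₀, b₀, k₁, b₁, -, -, h, e⟩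
    simp only [Nat.pair_eq_pair, encode_inj] at e
    obtain ⟨rfl, rfl, rfl, rfl⟩ := e
    exact h
  · exact fun h => ⟨i, _, j, _, K.tup_mem i, K.tup_mem j, h, rfl⟩

theorem IsCanonicalAgeOf.funIn_tup (O : Set ℕ) (hK : IsCanonicalAgeOf ∅ K M) :
    FunIn O K.tup :=
  ⟨_, hK.1.mono (setRecIn_empty O), fun _ => rfl⟩

theorem DecIn.eq {α β : Type} [Primcodable α] [Primcodable β] {O : Set ℕ} {f g : α → β}
    (hf : FunIn O f) (hg : FunIn O g) : DecIn O (fun a => f a = g a) :=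
  (DecIn.of_primrecPred (P := fun x : β × β => x.1 = x.2) Primrec.eq).comp (hf.pair hg)

theorem IsCanonicalAgeOf.decIn_tupleIn (O : Set ℕ) (hK : IsCanonicalAgeOf ∅ K M) :
    DecIn (jump O) (TupleIn M) := by
  have h : DecIn O (fun x : List ℕ × ℕ => K.tup x.2 = x.1) :=
    .eq ((hK.funIn_tup O).comp (.of_primrec .snd)) (.of_primrec .fst)
  have := h.exists_snd
  simpa only [← hK.tupleIn_iff] using this

/-- Some tuple extending `bs` is similar to `as ++ ds`. -/
def ExtendsAlong (M : Str L) (as bs ds : List ℕ) : Prop :=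
  TupleIn M (as ++ ds) ∧ ∃ ws, TupleIn M ws ∧ ClSim M (as ++ ds) M ws ∧ ws.take as.length = bs

theorem extendsAlong_nil {as bs : List ℕ} :
    ExtendsAlong M as bs [] ↔ TupleIn M as ∧ TupleIn M bs ∧ ClSim M as M bs := by
  rw [ExtendsAlong, List.append_nil]
  refine and_congr_right fun _ => ⟨?_, fun h => ⟨bs, h.1, h.2, ?_⟩⟩
  · rintro ⟨_, hw, ⟨h, rfl, hh⟩, rfl⟩
    rw [List.take_of_length_le (by simp)]
    exact ⟨hw, h, rfl, hh⟩
  · obtain ⟨h, rfl, -⟩ := h.2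
    simp

theorem sameOrbit_iff_extendsAlong (hM : CofinallyUltrahomogeneous M) {as bs : List ℕ} :
    SameOrbit M as bs ↔ TupleIn M as ∧ ∀ ds, TupleIn M ds → ExtendsAlong M as bs ds := by
  rw [sameOrbit_iff hM]
  refine and_congr_right fun ha => forall_congr' fun ds => imp_congr_right fun hd => ?_
  rw [ExtendsAlong, tupleIn_append]
  exact (and_iff_right ⟨ha, hd⟩).symm

theorem mem_homogeneousTuples_iff (hM : CofinallyUltrahomogeneous M) {as : List ℕ} :
    as ∈ homogeneousTuples M ↔ TupleIn M as ∧ ∀ x : List ℕ × List ℕ,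
      ExtendsAlong M as x.1 [] → TupleIn M x.2 → ExtendsAlong M as x.1 x.2 := by
  refine and_congr_right fun ha => ⟨fun h x hx hd => ?_, fun h bs hb hs => ?_⟩
  · obtain ⟨-, hb, hs⟩ := extendsAlong_nil.1 hx
    exact ((sameOrbit_iff_extendsAlong hM).1 (h _ hb hs)).2 _ hd
  · exact (sameOrbit_iff_extendsAlong hM).2
      ⟨ha, fun ds => h (bs, ds) (extendsAlong_nil.2 ⟨ha, hb, hs⟩)⟩

theorem IsCanonicalAgeOf.decIn_extendsAlong (hK : IsCanonicalAgeOf ∅ K M) :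
    DecIn (jump (EmbedInfo K))
      (fun x : (List ℕ × List ℕ) × List ℕ => ExtendsAlong M x.1.1 x.1.2 x.2) := by
  have hi : FunIn (EmbedInfo K) (fun x : ((List ℕ × List ℕ) × List ℕ) × (ℕ × ℕ) => x.2.1) :=
    .of_primrec (Primrec.fst.comp .snd)
  have hj : FunIn (EmbedInfo K) (fun x : ((List ℕ × List ℕ) × List ℕ) × (ℕ × ℕ) => x.2.2) :=
    .of_primrec (Primrec.snd.comp .snd)
  have has : Primrec (fun x : ((List ℕ × List ℕ) × List ℕ) × (ℕ × ℕ) => x.1.1.1) :=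
    Primrec.fst.comp (Primrec.fst.comp .fst)
  have ht := hK.funIn_tup (EmbedInfo K)
  have hc : FunIn (EmbedInfo K) (fun x : List ℕ => encode x) := .of_primrec .encode
  have hp : FunIn (EmbedInfo K) (fun x : ℕ × ℕ => Nat.pair x.1 x.2) :=
    .of_primrec (Primrec₂.natPair.comp .fst .snd)
  have htake : FunIn (EmbedInfo K) (fun x : ℕ × List ℕ => x.2.take x.1) :=
    .of_primrec (Primrec.list_take.comp .fst .snd)
  have h₁ : DecIn (EmbedInfo K) (fun x : ((List ℕ × List ℕ) × List ℕ) × (ℕ × ℕ) =>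
      K.tup x.2.1 = x.1.1.1 ++ x.1.2) :=
    .eq (ht.comp hi) (.of_primrec (Primrec.list_append.comp has (Primrec.snd.comp .fst)))
  have h₂ : DecIn (EmbedInfo K) (fun x : ((List ℕ × List ℕ) × List ℕ) × (ℕ × ℕ) =>
      Nat.pair x.2.1 (Nat.pair (encode (K.tup x.2.1))
        (Nat.pair x.2.2 (encode (K.tup x.2.2)))) ∈ EmbedInfo K) :=
    (DecIn.of_setRecIn (setRecIn_self _)).comp (hp.comp (hi.pair (hp.comp
      ((hc.comp (ht.comp hi)).pair (hp.comp (hj.pair (hc.comp (ht.comp hj))))))))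
  have h₃ : DecIn (EmbedInfo K) (fun x : ((List ℕ × List ℕ) × List ℕ) × (ℕ × ℕ) =>
      (K.tup x.2.2).take x.1.1.1.length = x.1.1.2) :=
    .eq (htake.comp ((FunIn.of_primrec (Primrec.list_length.comp has)).pair (ht.comp hj)))
      (.of_primrec (Primrec.snd.comp (Primrec.fst.comp .fst)))
  have h := (h₁.and (h₂.and h₃)).exists_snd
  have key : (fun x : (List ℕ × List ℕ) × List ℕ => ExtendsAlong M x.1.1 x.1.2 x.2) =
      fun x => ∃ ij : ℕ × ℕ, K.tup ij.1 = x.1.1 ++ x.2 ∧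
        Nat.pair ij.1 (Nat.pair (encode (K.tup ij.1))
          (Nat.pair ij.2 (encode (K.tup ij.2)))) ∈ EmbedInfo K ∧
        (K.tup ij.2).take x.1.1.length = x.1.2 := by
    funext ⟨⟨as, bs⟩, ds⟩
    simp only [hK.mem_embedInfo_iff, eq_iff_iff]
    constructor
    · rintro ⟨had, ws, hw, hs, e⟩
      obtain ⟨i, hi⟩ := hK.tupleIn_iff.1 had
      obtain ⟨j, rfl⟩ := hK.tupleIn_iff.1 hw
      exact ⟨(i, j), hi, by rwa [hi], e⟩
    · rintro ⟨⟨i, j⟩, hi, hs, e⟩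
      exact ⟨hi ▸ hK.2.1 i, K.tup j, hK.2.1 j, hi ▸ hs, e⟩
  rw [key]
  exact h

theorem IsCanonicalAgeOf.decIn_sameOrbit (hK : IsCanonicalAgeOf ∅ K M)
    (hM : CofinallyUltrahomogeneous M) :
    DecIn (jump (jump (EmbedInfo K))) (fun x : List ℕ × List ℕ => SameOrbit M x.1 x.2) := by
  have h₁ := ((hK.decIn_tupleIn (EmbedInfo K)).comp
    (f := fun x : (List ℕ × List ℕ) × List ℕ => x.2) (.of_primrec .snd)).imp hK.decIn_extendsAlong
  have h₂ := ((hK.decIn_tupleIn (jump (EmbedInfo K))).comp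
    (f := fun x : List ℕ × List ℕ => x.1) (.of_primrec .fst)).and h₁.forall_snd
  simpa only [← sameOrbit_iff_extendsAlong hM] using h₂

theorem IsCanonicalAgeOf.decIn_homogeneousTuples (hK : IsCanonicalAgeOf ∅ K M)
    (hM : CofinallyUltrahomogeneous M) :
    DecIn (jump (jump (EmbedInfo K))) (fun as => as ∈ homogeneousTuples M) := by
  have hab : Primrec (fun x : List ℕ × (List ℕ × List ℕ) => (x.1, x.2.1)) :=
    Primrec.fst.pair (Primrec.fst.comp .snd)
  have hd : Primrec (fun x : List ℕ × (List ℕ × List ℕ) => x.2.2) := Primrec.snd.comp .snd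
  have h₁ := hK.decIn_extendsAlong.comp (.of_primrec (hab.pair (.const [])))
  have h₂ := (hK.decIn_tupleIn (EmbedInfo K)).comp (.of_primrec hd)
  have h₃ := hK.decIn_extendsAlong.comp (.of_primrec (hab.pair hd))
  have h := (hK.decIn_tupleIn (jump (EmbedInfo K))).and (h₁.imp (h₂.imp h₃)).forall_snd
  simpa only [← mem_homogeneousTuples_iff hM] using h

theorem decIn_tupleSim (O : Set ℕ) :
    DecIn (jump O) (fun x : List ℕ × List ℕ => TupleSim x.1 x.2) := by
  have hi : Primrec (fun x : (List ℕ × List ℕ) × (ℕ × ℕ) => x.2.1) := Primrec.fst.comp .snd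
  have hj : Primrec (fun x : (List ℕ × List ℕ) × (ℕ × ℕ) => x.2.2) := Primrec.snd.comp .snd
  have hp : Primrec (fun x : (List ℕ × List ℕ) × (ℕ × ℕ) => x.1.1) := Primrec.fst.comp .fst
  have hq : Primrec (fun x : (List ℕ × List ℕ) × (ℕ × ℕ) => x.1.2) := Primrec.snd.comp .fst
  have h₁ : DecIn O (fun x : (List ℕ × List ℕ) × (ℕ × ℕ) => x.1.1[x.2.1]? = x.1.1[x.2.2]?) :=
    .eq (.of_primrec (Primrec.list_getElem?.comp hp hi))
      (.of_primrec (Primrec.list_getElem?.comp hp hj))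
  have h₂ : DecIn O (fun x : (List ℕ × List ℕ) × (ℕ × ℕ) => x.1.2[x.2.1]? = x.1.2[x.2.2]?) :=
    .eq (.of_primrec (Primrec.list_getElem?.comp hq hi))
      (.of_primrec (Primrec.list_getElem?.comp hq hj))
  have h := ((h₁.imp h₂).and (h₂.imp h₁)).forall_snd
  simpa only [tupleSim_iff, Prod.forall, iff_iff_implies_and_implies] using h

theorem IsCanonicalAgeOf.decIn_compatible (hK : IsCanonicalAgeOf ∅ K M)
    (hM : CofinallyUltrahomogeneous M) :
    DecIn (jump (jump (EmbedInfo K)))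
      (fun x : (List ℕ × List ℕ) × (List ℕ × List ℕ) => Compatible M x.1 x.2) := by
  have ht := hK.decIn_tupleIn (jump (EmbedInfo K))
  have ho := hK.decIn_sameOrbit hM
  exact ((ht.comp (.of_primrec (Primrec.fst.comp .snd))).and
      (ht.comp (.of_primrec (Primrec.snd.comp .snd)))).and
    (((decIn_tupleSim _).comp (.of_primrec .snd)).and
      ((ho.comp (.of_primrec .fst)).imp (ho.comp (.of_primrec .snd))))

theorem IsCanonicalAgeOf.decIn_dom (O : Set ℕ) (hK : IsCanonicalAgeOf ∅ K M) :
    DecIn (jump O) (fun n => n ∈ M.dom) := by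
  have := (hK.decIn_tupleIn O).comp
    (f := fun n : ℕ => [n]) (.of_primrec (Primrec.list_cons.comp .id (.const [])))
  simpa [TupleIn] using this

theorem funIn_limitMap_stage {O : Set ℕ} (hD : DecIn O (fun n => n ∈ M.dom))
    {F : ((List ℕ × List ℕ) × (List ℕ × List ℕ)) × ℕ → ℕ × ℕ} (hF : FunIn O F) :
    FunIn O (fun x : (List ℕ × List ℕ) × ℕ => limitMap (stage M F x.1) x.2) := by
  have hst : Primrec (fun x : (List ℕ × List ℕ) × (ℕ × (List ℕ × List ℕ)) => x.2.2) :=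
    Primrec.snd.comp .snd
  have hn : Primrec (fun x : (List ℕ × List ℕ) × (ℕ × (List ℕ × List ℕ)) => x.2.1) :=
    Primrec.fst.comp .snd
  have hF' := hF.comp (.of_primrec ((Primrec.fst.pair hst).pair hn))
  have hext : Primrec (fun x : ((List ℕ × List ℕ) × (ℕ × (List ℕ × List ℕ))) × (ℕ × ℕ) =>
      (x.2.2 :: x.1.2.1 :: x.1.2.2.1, x.1.2.1 :: x.2.1 :: x.1.2.2.2)) :=
    (Primrec.list_cons.comp (Primrec.snd.comp .snd)
      (Primrec.list_cons.comp (hn.comp .fst) (Primrec.fst.comp (hst.comp .fst)))).pair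
    (Primrec.list_cons.comp (hn.comp .fst)
      (Primrec.list_cons.comp (Primrec.fst.comp .snd) (Primrec.snd.comp (hst.comp .fst))))
  have hstage : FunIn O (fun x : (List ℕ × List ℕ) × ℕ => stage M F x.1 x.2) :=
    (FunIn.of_primrec Primrec.id).natRec (.ite (hD.comp (.of_primrec hn))
      ((FunIn.of_primrec hext).comp ((FunIn.of_primrec Primrec.id).pair hF')) (.of_primrec hst))
  have hlook : Primrec (fun x : (List ℕ × List ℕ) × ℕ => (x.1.2[x.1.1.idxOf x.2]?).getD 0) :=
    Primrec.option_getD.comp (Primrec.list_getElem?.comp (Primrec.snd.comp .fst)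
      (Primrec.list_idxOf.comp .snd (Primrec.fst.comp .fst))) (.const 0)
  exact (FunIn.of_primrec hlook).comp ((hstage.comp (.of_primrec
    (Primrec.fst.pair (Primrec.succ.comp .snd)))).pair (.of_primrec .snd))

/-- A uniformly computable family of functions has a computable function producing codes. -/
theorem FunIn.exists_code {O : Set ℕ} {G : (List ℕ × List ℕ) × ℕ → ℕ} (hG : FunIn O G) :
    ∃ c : OCode, ∀ as bs : List ℕ, ∃ c' : OCode,
      OCode.eval (chi O) c (Nat.pair (encode as) (encode bs)) = Part.some c'.encodeCode ∧
      ComputesIn O c' (fun x => G ((as, bs), x)) := by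
  obtain ⟨φ, ⟨d, hd⟩, hφ⟩ := hG
  obtain ⟨c, hc⟩ := TotalComputableIn.of_primrec (O := O) d.primrec_encodeCode_curry
  refine ⟨c, fun as bs => ⟨_, hc _, fun x => ?_⟩⟩
  have h := hφ ((as, bs), x)
  rw [encode_prod_val, encode_prod_val] at h
  rw [hd.curry _ x]
  exact congrArg Part.some h

theorem IsCanonicalAgeOf.cofUltraFunIn (hK : IsCanonicalAgeOf ∅ K M)
    (hM : CofinallyUltrahomogeneous M) :
    CofUltraFunIn (jump (jump (EmbedInfo K))) M (homogeneousTuples M) := by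
  have hD := hK.decIn_dom (jump (EmbedInfo K))
  have hC := hK.decIn_compatible hM
  have hab : Primrec
      (fun x : (((List ℕ × List ℕ) × (List ℕ × List ℕ)) × ℕ) × (ℕ × ℕ) => x.1.1.1) :=
    Primrec.fst.comp (Primrec.fst.comp .fst)
  have hst : Primrec
      (fun x : (((List ℕ × List ℕ) × (List ℕ × List ℕ)) × ℕ) × (ℕ × ℕ) => x.1.1.2) :=
    Primrec.snd.comp (Primrec.fst.comp .fst)
  have hn : Primrec
      (fun x : (((List ℕ × List ℕ) × (List ℕ × List ℕ)) × ℕ) × (ℕ × ℕ) => x.1.2) :=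
    Primrec.snd.comp .fst
  have hnew : Primrec
      (fun x : (((List ℕ × List ℕ) × (List ℕ × List ℕ)) × ℕ) × (ℕ × ℕ) =>
        (x.2.2 :: x.1.2 :: x.1.1.2.1, x.1.2 :: x.2.1 :: x.1.1.2.2)) :=
    (Primrec.list_cons.comp (Primrec.snd.comp .snd)
      (Primrec.list_cons.comp hn (Primrec.fst.comp hst))).pair
    (Primrec.list_cons.comp hn
      (Primrec.list_cons.comp (Primrec.fst.comp .snd) (Primrec.snd.comp hst)))
  have hP := (hC.comp (.of_primrec (Primrec.fst.comp .fst))).imp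
    ((hD.comp (.of_primrec hn)).imp (hC.comp (.of_primrec (hab.pair hnew))))
  obtain ⟨F, hF, hF'⟩ := hP.exists_choice fun x => by
    by_cases h : Compatible M x.1.1 x.1.2 ∧ x.2 ∈ M.dom
    · obtain ⟨yz, hyz⟩ := h.1.exists_step h.2
      exact ⟨yz, fun _ _ => hyz⟩
    · exact ⟨(0, 0), fun h₁ h₂ => absurd ⟨h₁, h₂⟩ h⟩
  obtain ⟨c, hc⟩ := (funIn_limitMap_stage hD hF).exists_code
  refine ⟨c, fun as ha bs hb hs => ?_⟩
  obtain ⟨c', hc₁, hc₂⟩ := hc as bs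
  have hcomp := compatible_stage (F := F) hF' (Compatible.refl (ab := (as, bs)) ha.1 hb hs)
  have hbf := isBackAndForth_stage hcomp
  exact ⟨_, hc₁, c', rfl, _, hc₂, hbf.bijOnDom, hbf.map_limitMap 0,
    fun hcl => hbf.isAutoOf fun n => (hcomp n).2.2 (ha.2 bs hb hcl)⟩

end Complexity

/-- A computable cofinally ultrahomogeneous structure is
`EmbedInfo(M)''`-computably cofinally ultrahomogeneous. -/
theorem cofultra_implies_double_jump_comp_cofultra {L : Lang} (hL : L.ComputableRep)
    (M : Str L) (hM : StrComputableIn ∅ M)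
    (hcu : CofinallyUltrahomogeneous M) :
    ∀ K : CompAge L, IsCanonicalAgeOf ∅ K M →
      CompCofUltrahom (jump (jump (EmbedInfo K))) M := by
  intro K hK
  exact ⟨homogeneousTuples M, isCofinalCollection_homogeneousTuples hcu,
    setRecIn_of_decIn (hK.decIn_homogeneousTuples hcu), hK.cofUltraFunIn hcu⟩

end CFL
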